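/- Let c ∈ ℝ, let q ∈ [0,1] be a constant, and let (p_n) be a sequence in [0,1] with n·p_n − log n → c. Then liminf_{n→∞} P(G_{n,p_n,q} ∈ D^n) ≥ e^{−2(1−q)e^{−c}} · (1 + 2(1−q)e^{−c} + (1−q)²e^{−2c}), where G_{n,p_n,q} is a digraph drawn from the random digraph model G(n, p_n, q) and D^n is the set of structurally diagonalizable n-vertex digraphs. -/

import Mathlib

open Finset Filter

/-- A matching in the bipartite representation of a digraph on `Fin n`:
a set of edges no two of which share a left endpoint or share a right endpoint. -/
def IsMatching (n : ℕ) (M : Finset (Fin n × Fin n)) : Prop :=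
  ∀ e ∈ M, ∀ f ∈ M, (e.1 = f.1 ∨ e.2 = f.2) → e = f

/-- `M` is a maximum matching of the bipartite representation of the digraph
with edge set `E`. -/
def IsMaxMatching (n : ℕ) (E M : Finset (Fin n × Fin n)) : Prop :=
  M ⊆ E ∧ IsMatching n M ∧ ∀ M' ⊆ E, IsMatching n M' → M'.card ≤ M.card

/-- The digraph `(V, M)` is a disjoint union of directed cycles and isolated
vertices: `M` is the graph of a permutation restricted to an invariant set `S`,
all vertices outside `S` being isolated. -/
def CyclesAndIsolated (n : ℕ) (M : Finset (Fin n × Fin n)) : Prop :=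
  ∃ σ : Equiv.Perm (Fin n), ∃ S : Finset (Fin n),
    (∀ u ∈ S, σ u ∈ S) ∧ M = S.image fun u => (u, σ u)

/-- A digraph is structurally diagonalizable if its bipartite representation has a
maximum matching `M` such that `(V, M)` is a disjoint union of directed cycles
and isolated vertices. -/
def StructurallyDiagonalizable (n : ℕ) (E : Finset (Fin n × Fin n)) : Prop :=
  ∃ M, IsMaxMatching n E M ∧ CyclesAndIsolated n M

/-- A Hamiltonian decomposition: a spanning subgraph that is a disjoint union of
directed cycles covering all `n` vertices, i.e. the functional graph of a
permutation contained in `E`. -/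
def HasHamiltonianDecomposition (n : ℕ) (E : Finset (Fin n × Fin n)) : Prop :=
  ∃ σ : Equiv.Perm (Fin n), ∀ u, (u, σ u) ∈ E

/-- A consistent matching of the bipartite representation of `E`: a matching whose
set of left endpoints equals its set of right endpoints. -/
def IsConsistentMatching (n : ℕ) (E M : Finset (Fin n × Fin n)) : Prop :=
  M ⊆ E ∧ IsMatching n M ∧ M.image Prod.fst = M.image Prod.snd

/-- Neighborhood, on the right side, of a set `I` of left vertices of `B(G)`. -/
def leftNbhd (n : ℕ) (E : Finset (Fin n × Fin n)) (I : Finset (Fin n)) :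
    Finset (Fin n) :=
  Finset.univ.filter fun v => ∃ u ∈ I, (u, v) ∈ E

/-- Neighborhood, on the left side, of a set `I` of right vertices of `B(G)`. -/
def rightNbhd (n : ℕ) (E : Finset (Fin n × Fin n)) (I : Finset (Fin n)) :
    Finset (Fin n) :=
  Finset.univ.filter fun u => ∃ v ∈ I, (u, v) ∈ E

/-- Membership in `F_k^n`: (1) some subset `I` of one side of `B(G)` has `|I| = k`
and `|N(I)| = k - 1`; (2) no subset `J` of either side with `|J| < k` satisfies
`|N(J)| = |J| - 1`. -/
def memF (n k : ℕ) (E : Finset (Fin n × Fin n)) : Prop :=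
  (∃ I : Finset (Fin n), I.card = k ∧
      ((leftNbhd n E I).card + 1 = k ∨ (rightNbhd n E I).card + 1 = k)) ∧
  ∀ J : Finset (Fin n), J.card < k →
      (leftNbhd n E J).card + 1 ≠ J.card ∧ (rightNbhd n E J).card + 1 ≠ J.card

/-- Membership in `L_k^n`: the bipartite representation of `E` admits a maximum
matching of size `n - k` that decomposes the digraph into disjoint cycles and
isolated vertices. -/
def memL (n k : ℕ) (E : Finset (Fin n × Fin n)) : Prop :=
  ∃ M, IsMaxMatching n E M ∧ M.card = n - k ∧ CyclesAndIsolated n M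

/-- The probability, under the random digraph model `G(n, p, q)` (each non-loop
edge present independently with probability `p`, each self-loop with
probability `q`), that the sampled digraph lies in the set `A`. -/
noncomputable def digraphProb (n : ℕ) (p q : ℝ)
    (A : Set (Finset (Fin n × Fin n))) : ℝ :=
  ∑ E : Finset (Fin n × Fin n),
    Set.indicator A (fun E =>
      (∏ e ∈ E, if e.1 = e.2 then q else p) *
      ∏ e ∈ Finset.univ \ E, if e.1 = e.2 then 1 - q else 1 - p) E

section BernoulliProb

variable {α : Type*} [Fintype α] [DecidableEq α]

/-- The weight of `E` when each `e : α` is selected independently with probability `x e`. -/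
noncomputable def bernWeight (x : α → ℝ) (E : Finset α) : ℝ :=
  (∏ e ∈ E, x e) * ∏ e ∈ Finset.univ \ E, (1 - x e)

/-- The probability of `A` when each `e : α` is selected independently with probability `x e`. -/
noncomputable def bernProb (x : α → ℝ) (A : Set (Finset α)) : ℝ :=
  ∑ E : Finset α, A.indicator (bernWeight x) E

variable {x : α → ℝ}

lemma bernWeight_nonneg (hx : ∀ e, x e ∈ Set.Icc (0 : ℝ) 1) (E : Finset α) :
    0 ≤ bernWeight x E :=
  mul_nonneg (prod_nonneg fun e _ => (hx e).1)
    (prod_nonneg fun e _ => sub_nonneg.2 (hx e).2)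

lemma bernProb_nonneg (hx : ∀ e, x e ∈ Set.Icc (0 : ℝ) 1) (A : Set (Finset α)) :
    0 ≤ bernProb x A :=
  sum_nonneg fun E _ => Set.indicator_nonneg (fun E _ => bernWeight_nonneg hx E) E

lemma bernProb_mono (hx : ∀ e, x e ∈ Set.Icc (0 : ℝ) 1) {A B : Set (Finset α)}
    (h : A ⊆ B) : bernProb x A ≤ bernProb x B :=
  sum_le_sum fun E _ => Set.indicator_le_indicator_of_subset h (bernWeight_nonneg hx) E

lemma bernProb_union_add_inter (A B : Set (Finset α)) :
    bernProb x (A ∪ B) + bernProb x (A ∩ B) = bernProb x A + bernProb x B := by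
  simp only [bernProb, ← sum_add_distrib]
  exact sum_congr rfl fun E _ => Set.indicator_union_add_inter_apply _ A B E

lemma bernProb_union_le (hx : ∀ e, x e ∈ Set.Icc (0 : ℝ) 1) (A B : Set (Finset α)) :
    bernProb x (A ∪ B) ≤ bernProb x A + bernProb x B := by
  have := bernProb_nonneg hx (A ∩ B)
  have := bernProb_union_add_inter (x := x) A B
  linarith

lemma bernProb_biUnion_le {ι : Type*} (hx : ∀ e, x e ∈ Set.Icc (0 : ℝ) 1) (I : Finset ι)
    (A : ι → Set (Finset α)) :
    bernProb x {E | ∃ i ∈ I, E ∈ A i} ≤ ∑ i ∈ I, bernProb x (A i) := by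
  classical
  induction I using Finset.induction_on with
  | empty => simp [bernProb]
  | insert i I hi ih =>
    rw [sum_insert hi]
    refine le_trans (bernProb_mono hx (B := A i ∪ {E | ∃ i ∈ I, E ∈ A i}) ?_)
      ((bernProb_union_le hx _ _).trans (by gcongr))
    rintro E ⟨j, hj, hE⟩
    rcases mem_insert.1 hj with rfl | hj
    · exact Or.inl hE
    · exact Or.inr ⟨j, hj, hE⟩

lemma bernProb_cylinder {S T : Finset α} (h : Disjoint S T) :
    bernProb x {E | Disjoint S E ∧ T ⊆ E} = (∏ e ∈ S, (1 - x e)) * ∏ e ∈ T, x e := by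
  have key : ∀ E : Finset α, ({E | Disjoint S E ∧ T ⊆ E} : Set (Finset α)).indicator
      (bernWeight x) E = (∏ e ∈ E, if e ∈ S then 0 else x e) *
        ∏ e ∈ Finset.univ \ E, if e ∈ T then 0 else 1 - x e := by
    intro E
    by_cases hE : Disjoint S E ∧ T ⊆ E
    · rw [Set.indicator_of_mem (by exact hE), bernWeight]
      congr 1
      · refine prod_congr rfl fun e he => ?_
        rw [if_neg fun hs => Finset.disjoint_left.1 hE.1 hs he]
      · refine prod_congr rfl fun e he => ?_
        rw [if_neg fun hs => (mem_sdiff.1 he).2 (hE.2 hs)]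
    · rw [Set.indicator_of_notMem (by exact hE)]
      rw [not_and_or, Finset.not_disjoint_iff, Finset.not_subset] at hE
      symm
      rcases hE with ⟨e, h1, h2⟩ | ⟨e, h1, h2⟩
      · rw [Finset.prod_eq_zero h2 (by simp [h1]), zero_mul]
      · rw [Finset.prod_eq_zero (i := e) (s := Finset.univ \ E) (by simpa using h2)
          (by simp [h1]), mul_zero]
  have h2 := Finset.prod_add (fun e => if e ∈ S then 0 else x e)
    (fun e => if e ∈ T then 0 else 1 - x e) Finset.univ
  rw [Finset.powerset_univ] at h2
  rw [bernProb, sum_congr rfl fun E _ => key E, ← h2]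
  have h3 : ∀ e, (if e ∈ S then 0 else x e) + (if e ∈ T then 0 else 1 - x e) =
      (if e ∈ S then 1 - x e else 1) * (if e ∈ T then x e else 1) := by
    intro e
    by_cases hs : e ∈ S
    · have := Finset.disjoint_left.1 h hs
      simp [hs, this]
    · by_cases ht : e ∈ T <;> simp [hs, ht]
  rw [prod_congr rfl fun e _ => h3 e, prod_mul_distrib, Finset.prod_ite_mem,
    Finset.prod_ite_mem, Finset.univ_inter, Finset.univ_inter]

lemma bernProb_map (f : α ≃ α) (hf : ∀ e, x (f e) = x e) (A : Set (Finset α)) :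
    bernProb x {E | E.map f.toEmbedding ∈ A} = bernProb x A := by
  refine Fintype.sum_equiv f.finsetCongr _ _ fun E => ?_
  have hw : bernWeight x (E.map f.toEmbedding) = bernWeight x E := by
    have : Finset.univ \ E.map f.toEmbedding = (Finset.univ \ E).map f.toEmbedding := by
      ext e
      simp [Finset.mem_map_equiv]
    rw [bernWeight, this, prod_map, prod_map]
    simp [bernWeight, hf]
  by_cases h : E.map f.toEmbedding ∈ A
  · rw [Set.indicator_of_mem (by exact h), Equiv.finsetCongr_apply, Set.indicator_of_mem h, hw]
  · rw [Set.indicator_of_notMem (by exact h), Equiv.finsetCongr_apply,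
      Set.indicator_of_notMem h]

/-- A union bound over independent choices: `S` is avoided, and each `b ∈ I` realises one of the
pairwise compatible patterns `T b i`, `i ∈ J b`. -/
lemma bernProb_forall_exists_le {β γ : Type*} (hx : ∀ e, x e ∈ Set.Icc (0 : ℝ) 1)
    (S : Finset α) (I : Finset β) (J : β → Finset γ) (T : β → γ → Finset α)
    (hS : ∀ b ∈ I, ∀ i ∈ J b, Disjoint S (T b i))
    (hT : ∀ b ∈ I, ∀ b' ∈ I, b ≠ b' → ∀ i ∈ J b, ∀ i' ∈ J b', Disjoint (T b i) (T b' i')) :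
    bernProb x {E | Disjoint S E ∧ ∀ b ∈ I, ∃ i ∈ J b, T b i ⊆ E} ≤
      (∏ e ∈ S, (1 - x e)) * ∏ b ∈ I, ∑ i ∈ J b, ∏ e ∈ T b i, x e := by
  classical
  suffices H : ∀ T₀ : Finset α, Disjoint S T₀ →
      (∀ b ∈ I, ∀ i ∈ J b, Disjoint T₀ (T b i)) →
      bernProb x {E | Disjoint S E ∧ T₀ ⊆ E ∧ ∀ b ∈ I, ∃ i ∈ J b, T b i ⊆ E} ≤
        (∏ e ∈ S, (1 - x e)) * (∏ e ∈ T₀, x e) * ∏ b ∈ I, ∑ i ∈ J b, ∏ e ∈ T b i, x e by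
    simpa using H ∅ (by simp) (by simp)
  induction I using Finset.induction_on with
  | empty =>
    intro T₀ h _
    simpa using (bernProb_cylinder h).le
  | insert b I hb ih =>
    intro T₀ h h0
    rw [prod_insert hb, Finset.sum_mul, Finset.mul_sum]
    refine le_trans (bernProb_mono hx (B := {E | ∃ i ∈ J b, E ∈ {E | Disjoint S E ∧
      T₀ ∪ T b i ⊆ E ∧ ∀ b ∈ I, ∃ i ∈ J b, T b i ⊆ E}}) ?_)
      ((bernProb_biUnion_le hx _ _).trans (sum_le_sum fun i hi => ?_))
    · rintro E ⟨h1, h2, h3⟩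
      obtain ⟨i, hi, hiE⟩ := h3 b (mem_insert_self _ _)
      exact ⟨i, hi, h1, union_subset h2 hiE, fun b' hb' => h3 b' (mem_insert_of_mem hb')⟩
    · have hbI : ∀ b' ∈ I, b ≠ b' := fun b' hb' hh => hb (hh ▸ hb')
      refine (ih (fun b' hb' => hS b' (mem_insert_of_mem hb'))
        (fun b' hb' b'' hb'' => hT b' (mem_insert_of_mem hb') b'' (mem_insert_of_mem hb''))
        (T₀ ∪ T b i) (disjoint_union_right.2 ⟨h, hS b (mem_insert_self _ _) i hi⟩)
        fun b' hb' i' hi' => disjoint_union_left.2 ⟨h0 b' (mem_insert_of_mem hb') i' hi',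
          hT b (mem_insert_self _ _) b' (mem_insert_of_mem hb') (hbI b' hb') i hi i' hi'⟩).trans ?_
      rw [prod_union (h0 b (mem_insert_self _ _) i hi)]
      exact le_of_eq (by ring)

end BernoulliProb

section Obstruction

variable {V : Type*}

/-- The `R`-neighbours in `W` of a set `A`. -/
noncomputable def nbrsIn (R : V → V → Prop) (W A : Finset V) : Finset V := by
  classical exact W.filter fun v => ∃ a ∈ A, R a v

lemma mem_nbrsIn {R : V → V → Prop} {W A : Finset V} {v : V} :
    v ∈ nbrsIn R W A ↔ v ∈ W ∧ ∃ a ∈ A, R a v := by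
  simp [nbrsIn]

variable [DecidableEq V]

/-- A minimal obstruction to Hall's condition for the relation `R` on `W`: the neighbours in `W`
of `A` lie in `B`, where `#B = #A - 1`, and each element of `B` has two neighbours in `A`. -/
structure HallObstruction (R : V → V → Prop) (W A B : Finset V) : Prop where
  left_subset : A ⊆ W
  right_subset : B ⊆ W
  card_eq : A.card = B.card + 1
  one_le : 1 ≤ B.card
  two_mul_le : 2 * A.card ≤ W.card + 1
  not_rel : ∀ a ∈ A, ∀ v ∈ W \ B, ¬ R a v
  exists_two : ∀ b ∈ B, ∃ a ∈ A, ∃ a' ∈ A, a ≠ a' ∧ R a b ∧ R a' b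

lemma hallObstruction_of_minimal {R : V → V → Prop} {W A : Finset V} (hA : A ⊆ W)
    (hrow : ∀ u ∈ W, ∃ v ∈ W, R u v) (hlt : (nbrsIn R W A).card < A.card)
    (hmin : ∀ A' ⊆ W, A'.card < A.card → A'.card ≤ (nbrsIn R W A').card ∧
      A'.card ≤ (nbrsIn (flip R) W A').card) :
    HallObstruction R W A (nbrsIn R W A) := by
  have hBW : nbrsIn R W A ⊆ W := fun v hv => (mem_nbrsIn.1 hv).1
  have hsub : ∀ a ∈ A, nbrsIn R W (A.erase a) ⊆ nbrsIn R W A := by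
    intro a _ v hv
    obtain ⟨h1, b, hb, h2⟩ := mem_nbrsIn.1 hv
    exact mem_nbrsIn.2 ⟨h1, b, mem_of_mem_erase hb, h2⟩
  have herase : ∀ a ∈ A, A.card ≤ (nbrsIn R W (A.erase a)).card + 1 := by
    intro a ha
    have h1 := Finset.card_erase_add_one ha
    have h2 := (hmin (A.erase a) ((erase_subset _ _).trans hA) (by omega)).1
    omega
  obtain ⟨a₀, ha₀⟩ : A.Nonempty := card_pos.1 (by omega)
  have hcard : A.card = (nbrsIn R W A).card + 1 := by
    have h1 := card_le_card (hsub a₀ ha₀)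
    have h2 := herase a₀ ha₀
    omega
  have heq : ∀ a ∈ A, nbrsIn R W (A.erase a) = nbrsIn R W A := fun a ha =>
    eq_of_subset_of_card_le (hsub a ha) (by have := herase a ha; omega)
  refine ⟨hA, hBW, hcard, ?_, ?_, ?_, ?_⟩
  · obtain ⟨v, hv, hR⟩ := hrow a₀ (hA ha₀)
    exact card_pos.2 ⟨v, mem_nbrsIn.2 ⟨hv, a₀, ha₀, hR⟩⟩
  · by_contra hcon
    have hc1 := card_sdiff_add_card_eq_card hBW
    have hc2 := card_sdiff_add_card_eq_card hA
    have h1 := (hmin (W \ nbrsIn R W A) sdiff_subset (by omega)).2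
    have h2 : nbrsIn (flip R) W (W \ nbrsIn R W A) ⊆ W \ A := by
      intro u hu
      obtain ⟨hu, v, hv, hR⟩ := mem_nbrsIn.1 hu
      refine mem_sdiff.2 ⟨hu, fun huA => (mem_sdiff.1 hv).2 ?_⟩
      exact mem_nbrsIn.2 ⟨(mem_sdiff.1 hv).1, u, huA, hR⟩
    have h3 := card_le_card h2
    omega
  · intro a ha v hv hR
    exact (mem_sdiff.1 hv).2 (mem_nbrsIn.2 ⟨(mem_sdiff.1 hv).1, a, ha, hR⟩)
  · intro b hb
    obtain ⟨_, a, ha, hR⟩ := mem_nbrsIn.1 hb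
    have hb' := hb
    rw [← heq a ha] at hb'
    obtain ⟨_, a', ha', hR'⟩ := mem_nbrsIn.1 hb'
    exact ⟨a, ha, a', mem_of_mem_erase ha', (ne_of_mem_erase ha').symm, hR, hR'⟩

lemma exists_perm_or_hallObstruction (R : V → V → Prop) (W : Finset V)
    (hrow : ∀ u ∈ W, ∃ v ∈ W, R u v) (hcol : ∀ v ∈ W, ∃ u ∈ W, R u v) :
    (∃ σ : Equiv.Perm V, ∀ u ∈ W, σ u ∈ W ∧ R u (σ u)) ∨
      ∃ A B, HallObstruction R W A B ∨ HallObstruction (flip R) W A B := by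
  classical
  by_cases hv : ∃ k, ∃ A ⊆ W, A.card = k ∧
      ((nbrsIn R W A).card < A.card ∨ (nbrsIn (flip R) W A).card < A.card)
  · right
    obtain ⟨A, hA, hk, h⟩ := Nat.find_spec hv
    have hmin : ∀ A' ⊆ W, A'.card < A.card → A'.card ≤ (nbrsIn R W A').card ∧
        A'.card ≤ (nbrsIn (flip R) W A').card := by
      intro A' hA' hlt
      by_contra hcon
      refine Nat.find_min hv (hk ▸ hlt) ⟨A', hA', rfl, ?_⟩
      by_contra hcon2
      push Not at hcon2
      exact hcon hcon2
    rcases h with h | h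
    · exact ⟨A, _, Or.inl (hallObstruction_of_minimal hA hrow h hmin)⟩
    · exact ⟨A, _, Or.inr (hallObstruction_of_minimal (R := flip R) hA hcol h
        fun A' h1 h2 => (hmin A' h1 h2).symm)⟩
  · left
    push Not at hv
    have hall := (Finset.all_card_le_biUnion_card_iff_exists_injective
      (fun u : W => W.filter (R u))).1 ?_
    · obtain ⟨f, hf, hfR⟩ := hall
      have hfR' : ∀ u, f u ∈ W ∧ R u (f u) := fun u => by simpa using hfR u
      let g : W → W := fun u => ⟨f u, (hfR' u).1⟩
      have hg : Function.Injective g := fun u v h => hf (by simpa [g] using h)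
      let e : Equiv.Perm W := Equiv.ofBijective g (Finite.injective_iff_bijective.1 hg)
      refine ⟨Equiv.Perm.ofSubtype e, fun u hu => ?_⟩
      have : Equiv.Perm.ofSubtype e u = f ⟨u, hu⟩ := by
        rw [Equiv.Perm.ofSubtype_apply_of_mem e hu]
        rfl
      rw [this]
      exact hfR' ⟨u, hu⟩
    · intro s
      have h := (hv _ (s.map (Function.Embedding.subtype _)) (fun u hu => by
        obtain ⟨w, _, rfl⟩ := mem_map.1 hu
        exact w.2) rfl).1
      rw [card_map] at h
      refine h.trans (card_le_card fun v hv => ?_)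
      obtain ⟨hvW, a, ha, hR⟩ := mem_nbrsIn.1 hv
      obtain ⟨w, hw, rfl⟩ := mem_map.1 ha
      exact mem_biUnion.2 ⟨w, hw, mem_filter.2 ⟨hvW, hR⟩⟩

end Obstruction

/-- All edges of `E` start in a vertex set that is covered by vertex-disjoint cycles of `E`. -/
def HasRowFactor (n : ℕ) (E : Finset (Fin n × Fin n)) : Prop :=
  ∃ σ : Equiv.Perm (Fin n), ∃ W : Finset (Fin n),
    (∀ u ∈ W, σ u ∈ W) ∧ (∀ u ∈ W, (u, σ u) ∈ E) ∧ ∀ e ∈ E, e.1 ∈ W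

lemma structurallyDiagonalizable_of_perm {n : ℕ} {E : Finset (Fin n × Fin n)}
    {σ : Equiv.Perm (Fin n)} {W : Finset (Fin n)} (hW : ∀ u ∈ W, σ u ∈ W)
    (hE : ∀ u ∈ W, (u, σ u) ∈ E) (h : (∀ e ∈ E, e.1 ∈ W) ∨ ∀ e ∈ E, e.2 ∈ W) :
    StructurallyDiagonalizable n E := by
  refine ⟨W.image fun u => (u, σ u), ⟨?_, ?_, ?_⟩, σ, W, hW, rfl⟩
  · intro e he
    obtain ⟨u, hu, rfl⟩ := mem_image.1 he
    exact hE u hu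
  · intro e he f hf hef
    obtain ⟨u, hu, rfl⟩ := mem_image.1 he
    obtain ⟨v, hv, rfl⟩ := mem_image.1 hf
    rcases hef with hef | hef
    · cases hef
      rfl
    · cases σ.injective hef
      rfl
  · intro M hM hMm
    rw [card_image_of_injective _ fun u v huv => congrArg Prod.fst huv]
    rcases h with h | h
    · exact card_le_card_of_injOn Prod.fst (fun e he => h e (hM he))
        fun e he f hf hef => hMm e he f hf (Or.inl hef)
    · exact card_le_card_of_injOn Prod.snd (fun e he => h e (hM he))
        fun e he f hf hef => hMm e he f hf (Or.inr hef)

lemma HasRowFactor.structurallyDiagonalizable {n : ℕ} {E : Finset (Fin n × Fin n)}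
    (h : HasRowFactor n E) : StructurallyDiagonalizable n E := by
  obtain ⟨σ, W, h1, h2, h3⟩ := h
  exact structurallyDiagonalizable_of_perm h1 h2 (Or.inl h3)

lemma HasRowFactor.structurallyDiagonalizable_of_swap {n : ℕ} {E : Finset (Fin n × Fin n)}
    (h : HasRowFactor n (E.map (Equiv.prodComm _ _).toEmbedding)) :
    StructurallyDiagonalizable n E := by
  obtain ⟨σ, W, h1, h2, h3⟩ := h
  have hmem : ∀ u v, (u, v) ∈ E.map (Equiv.prodComm (Fin n) (Fin n)).toEmbedding ↔
      (v, u) ∈ E := by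
    intro u v
    simp [Finset.mem_map_equiv]
  have hσ : ∀ u ∈ W, σ.symm u ∈ W := by
    have himg : W.image σ = W :=
      eq_of_subset_of_card_le (fun v hv => by
        obtain ⟨u, hu, rfl⟩ := mem_image.1 hv
        exact h1 u hu) (card_image_of_injective _ σ.injective).ge
    intro u hu
    rw [← himg] at hu
    obtain ⟨v, hv, rfl⟩ := mem_image.1 hu
    simpa using hv
  refine structurallyDiagonalizable_of_perm (σ := σ.symm) (W := W) hσ (fun u hu => ?_)
    (Or.inr fun e he => h3 (e.2, e.1) ((hmem _ _).2 he))
  have := (hmem _ _).1 (h2 _ (hσ u hu))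
  simpa using this

/-- The edge probabilities of the random digraph model `G(n, p, q)`. -/
noncomputable def edgeProb (n : ℕ) (p q : ℝ) (e : Fin n × Fin n) : ℝ :=
  if e.1 = e.2 then q else p

section Digraph

variable {n : ℕ} {p q : ℝ}

lemma edgeProb_mem (hp : p ∈ Set.Icc (0 : ℝ) 1) (hq : q ∈ Set.Icc (0 : ℝ) 1)
    (e : Fin n × Fin n) : edgeProb n p q e ∈ Set.Icc (0 : ℝ) 1 := by
  unfold edgeProb
  split_ifs
  exacts [hq, hp]

lemma edgeProb_prodComm (e : Fin n × Fin n) :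
    edgeProb n p q (Equiv.prodComm _ _ e) = edgeProb n p q e := by
  simp [edgeProb, eq_comm]

lemma digraphProb_eq_bernProb (A : Set (Finset (Fin n × Fin n))) :
    digraphProb n p q A = bernProb (edgeProb n p q) A := by
  refine sum_congr rfl fun E _ => congrArg (fun f => A.indicator f E) (funext fun E => ?_)
  refine congrArg _ (prod_congr rfl fun e _ => ?_)
  unfold edgeProb
  split_ifs <;> rfl

lemma prod_one_sub_edgeProb_row (i : Fin n) (S : Finset (Fin n)) :
    ∏ v ∈ S, (1 - edgeProb n p q (i, v)) =
      if i ∈ S then (1 - q) * (1 - p) ^ (S.card - 1) else (1 - p) ^ S.card := by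
  have h0 : ∀ T : Finset (Fin n), i ∉ T →
      ∏ v ∈ T, (1 - edgeProb n p q (i, v)) = (1 - p) ^ T.card := by
    intro T hT
    rw [← prod_const]
    refine prod_congr rfl fun v hv => ?_
    rw [edgeProb, if_neg fun h : i = v => hT (h ▸ hv)]
  split_ifs with h
  · rw [← mul_prod_erase S _ h, h0 _ (notMem_erase i S), card_erase_of_mem h]
    simp [edgeProb]
  · exact h0 S h

/-- The probability that a given vertex has no out-edges. -/
noncomputable def emptyRowProb (n : ℕ) (p q : ℝ) : ℝ := (1 - q) * (1 - p) ^ (n - 1)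

lemma prod_one_sub_edgeProb_univ (i : Fin n) :
    ∏ v, (1 - edgeProb n p q (i, v)) = emptyRowProb n p q := by
  rw [prod_one_sub_edgeProb_row, if_pos (mem_univ _), card_univ, Fintype.card_fin, emptyRowProb]

lemma bernProb_cols_empty_rows_nonempty (S : Finset (Fin n)) :
    bernProb (edgeProb n p q)
      {E | (∀ i, ∀ v ∈ S, (i, v) ∉ E) ∧ ∀ i, ∃ v, (i, v) ∈ E} =
    ∏ i : Fin n, (∏ v ∈ S, (1 - edgeProb n p q (i, v)) - emptyRowProb n p q) := by
  classical
  let C : Finset (Fin n) → Finset (Fin n × Fin n) := fun R =>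
    Finset.univ.filter fun e => e.1 ∈ R ∨ e.2 ∈ S
  have hind : ∀ E : Finset (Fin n × Fin n),
      ({E | (∀ i, ∀ v ∈ S, (i, v) ∉ E) ∧ ∀ i, ∃ v, (i, v) ∈ E} :
        Set (Finset (Fin n × Fin n))).indicator (bernWeight (edgeProb n p q)) E =
      ∑ R : Finset (Fin n), (-1) ^ R.card *
        ({E | Disjoint (C R) E ∧ ∅ ⊆ E} : Set (Finset (Fin n × Fin n))).indicator
          (bernWeight (edgeProb n p q)) E := by
    intro E
    let Z : Finset (Fin n) := Finset.univ.filter fun i => ∀ v, (i, v) ∉ E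
    have hC : ∀ R, (Disjoint (C R) E ∧ ∅ ⊆ E) ↔ (∀ i, ∀ v ∈ S, (i, v) ∉ E) ∧ R ⊆ Z := by
      intro R
      rw [and_iff_left (empty_subset E)]
      simp only [C, Z, Finset.disjoint_left, mem_filter, mem_univ, true_and, Prod.forall,
        subset_iff]
      constructor
      · exact fun h => ⟨fun i v hv => h i v (Or.inr hv), fun i hi v => h i v (Or.inl hi)⟩
      · rintro ⟨h1, h2⟩ i v (h | h)
        exacts [h2 h v, h1 i v h]
    simp only [Set.indicator_apply, Set.mem_ofPred_eq, hC]
    by_cases h1 : ∀ i, ∀ v ∈ S, (i, v) ∉ E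
    · simp only [and_iff_right h1, mul_ite, mul_zero]
      rw [← Finset.sum_filter, ← Finset.sum_mul]
      have hf : Finset.univ.filter (fun R => R ⊆ Z) = Z.powerset := by
        ext R
        simp
      have hs : (∑ R ∈ Z.powerset, (-1 : ℝ) ^ R.card) = if Z = ∅ then 1 else 0 := by
        exact_mod_cast Finset.sum_powerset_neg_one_pow_card (x := Z)
      have hZ : Z = ∅ ↔ ∀ i, ∃ v, (i, v) ∈ E := by
        simp [Z, Finset.filter_eq_empty_iff]
      rw [hf, hs]
      simp only [hZ, ite_mul, one_mul, zero_mul]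
    · simp [h1]
  rw [bernProb, sum_congr rfl fun E _ => hind E, Finset.sum_comm]
  have hP : ∀ R : Finset (Fin n), ∑ E : Finset (Fin n × Fin n), (-1 : ℝ) ^ R.card *
      ({E | Disjoint (C R) E ∧ ∅ ⊆ E} : Set (Finset (Fin n × Fin n))).indicator
          (bernWeight (edgeProb n p q)) E =
      (∏ i ∈ R, (-emptyRowProb n p q)) *
        ∏ i ∈ Finset.univ \ R, ∏ v ∈ S, (1 - edgeProb n p q (i, v)) := by
    intro R
    rw [← Finset.mul_sum]
    have := bernProb_cylinder (x := edgeProb n p q) (S := C R) (T := ∅) (disjoint_empty_right _)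
    rw [bernProb] at this
    rw [this, prod_empty, mul_one, prod_const, neg_pow (emptyRowProb n p q), mul_assoc]
    congr 1
    rw [prod_filter, Fintype.prod_prod_type, ← prod_sdiff (subset_univ R), mul_comm]
    congr 1
    · rw [← prod_const]
      refine prod_congr rfl fun i hi => ?_
      rw [← prod_one_sub_edgeProb_univ i]
      exact prod_congr rfl fun v _ => by simp [hi]
    · refine prod_congr rfl fun i hi => ?_
      have hi' := (mem_sdiff.1 hi).2
      simp only [hi', false_or]
      rw [Finset.prod_ite_mem, univ_inter]
  rw [sum_congr rfl fun R _ => hP R]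
  have := Finset.prod_add (fun _ : Fin n => -emptyRowProb n p q)
    (fun i => ∏ v ∈ S, (1 - edgeProb n p q (i, v))) Finset.univ
  rw [powerset_univ] at this
  rw [← this]
  exact prod_congr rfl fun i _ => by ring

lemma bernProb_rows_nonempty :
    bernProb (edgeProb n p q) {E | ∀ i, ∃ v, (i, v) ∈ E} = (1 - emptyRowProb n p q) ^ n := by
  have := bernProb_cols_empty_rows_nonempty (n := n) (p := p) (q := q) ∅
  simpa using this

lemma bernProb_cols_nonempty :
    bernProb (edgeProb n p q) {E | ∀ v, ∃ i, (i, v) ∈ E} = (1 - emptyRowProb n p q) ^ n := by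
  rw [← bernProb_rows_nonempty, ← bernProb_map (Equiv.prodComm _ _) edgeProb_prodComm]
  simp [Finset.mem_map_equiv]

/-- The probability that a given set of `s` vertices have no in-edges and all vertices have
out-edges. -/
noncomputable def emptyColsProb (n s : ℕ) (p q : ℝ) : ℝ :=
  ((1 - p) ^ s - emptyRowProb n p q) ^ (n - s) *
    ((1 - q) * (1 - p) ^ (s - 1) - emptyRowProb n p q) ^ s

lemma bernProb_cols_empty_rows_nonempty_eq (S : Finset (Fin n)) :
    bernProb (edgeProb n p q)
      {E | (∀ i, ∀ v ∈ S, (i, v) ∉ E) ∧ ∀ i, ∃ v, (i, v) ∈ E} =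
    emptyColsProb n S.card p q := by
  rw [bernProb_cols_empty_rows_nonempty, ← prod_sdiff (subset_univ S), emptyColsProb]
  congr 1
  · rw [prod_congr rfl fun i hi => by
      rw [prod_one_sub_edgeProb_row, if_neg (mem_sdiff.1 hi).2], prod_const,
      card_sdiff_of_subset (subset_univ S), card_univ, Fintype.card_fin]
  · rw [prod_congr rfl fun i hi => by rw [prod_one_sub_edgeProb_row, if_pos hi], prod_const]

lemma one_le_alternating_sum_choose (z m : ℕ) :
    (if z = 0 then 1 else 0 : ℝ) ≤ ∑ s ∈ Finset.range (2 * m + 1), (-1) ^ s * (z.choose s : ℝ) := by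
  have h : (∑ s ∈ Finset.range (2 * m + 1), (-1) ^ s * (z.choose s : ℝ)) =
      ((∑ s ∈ Finset.range (2 * m + 1), (-1) ^ s * (z.choose s : ℤ) : ℤ) : ℝ) := by
    push_cast
    rfl
  rcases z with _ | z
  · rw [h, Finset.sum_range_succ']
    simp
  · rw [h, Int.alternating_sum_range_choose_eq_choose]
    simp

/-- Bonferroni's upper bound for the probability that all vertices have both in-edges and
out-edges. -/
lemma bernProb_rows_nonempty_cols_nonempty_le (hp : p ∈ Set.Icc (0 : ℝ) 1)
    (hq : q ∈ Set.Icc (0 : ℝ) 1) (m : ℕ) :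
    bernProb (edgeProb n p q)
      ({E | ∀ i, ∃ v, (i, v) ∈ E} ∩ {E | ∀ v, ∃ i, (i, v) ∈ E}) ≤
    ∑ s ∈ Finset.range (2 * m + 1), (-1) ^ s * ((n.choose s : ℝ) * emptyColsProb n s p q) := by
  classical
  have h1 : ∀ s, (n.choose s : ℝ) * emptyColsProb n s p q =
      ∑ S ∈ Finset.powersetCard s (Finset.univ : Finset (Fin n)), bernProb (edgeProb n p q)
        {E | (∀ i, ∀ v ∈ S, (i, v) ∉ E) ∧ ∀ i, ∃ v, (i, v) ∈ E} := by
    intro s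
    rw [sum_congr rfl fun S hS => by
      rw [bernProb_cols_empty_rows_nonempty_eq, (mem_powersetCard.1 hS).2]]
    simp
  simp only [h1, bernProb]
  simp only [Finset.sum_comm (s := Finset.powersetCard _ _), Finset.mul_sum]
  rw [Finset.sum_comm]
  refine sum_le_sum fun E _ => ?_
  simp only [← Finset.mul_sum]
  by_cases hr : ∀ i, ∃ v, (i, v) ∈ E
  · let Z : Finset (Fin n) := Finset.univ.filter fun v => ∀ i, (i, v) ∉ E
    have h2 : ∀ s, ∑ S ∈ Finset.powersetCard s (Finset.univ : Finset (Fin n)),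
        ({E | (∀ i, ∀ v ∈ S, (i, v) ∉ E) ∧ ∀ i, ∃ v, (i, v) ∈ E} :
          Set (Finset (Fin n × Fin n))).indicator (bernWeight (edgeProb n p q)) E =
        (Z.card.choose s : ℝ) * bernWeight (edgeProb n p q) E := by
      intro s
      have hZ : ∀ S : Finset (Fin n), (∀ i, ∀ v ∈ S, (i, v) ∉ E) ↔ S ⊆ Z := by
        intro S
        simp only [Z, subset_iff, mem_filter, mem_univ, true_and]
        exact ⟨fun h v hv i => h i v hv, fun h i v hv => h hv i⟩
      simp only [Set.indicator_apply, Set.mem_ofPred_eq, hZ, hr, implies_true, and_true]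
      rw [← Finset.sum_filter, sum_const, nsmul_eq_mul, ← card_powersetCard]
      congr 3
      ext S
      simp [mem_powersetCard, and_comm]
    simp only [h2]
    have h3 := mul_le_mul_of_nonneg_right (one_le_alternating_sum_choose Z.card m)
      (bernWeight_nonneg (edgeProb_mem hp hq) E)
    rw [Finset.sum_mul] at h3
    simp only [mul_assoc] at h3
    refine le_trans (le_of_eq ?_) h3
    have hZ : Z.card = 0 ↔ ∀ v, ∃ i, (i, v) ∈ E := by
      simp [Z, Finset.filter_eq_empty_iff]
    simp only [Set.indicator_apply, Set.mem_inter_iff, Set.mem_ofPred_eq, hr, implies_true,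
      true_and, hZ, ite_mul, one_mul, zero_mul]
  · simp [hr]

end Digraph

/-- Elementary symmetric polynomials are bounded via the generating function. -/
lemma sum_powersetCard_prod_le {ι : Type*} (W : Finset ι) {w : ι → ℝ}
    (hw : ∀ b, 0 ≤ w b) {Y : ℝ} (hY : 0 < Y) (h : ∑ b ∈ W, w b ≤ Y) {l : ℕ} (hl : 1 ≤ l) :
    ∑ B ∈ W.powersetCard l, ∏ b ∈ B, w b ≤ (Real.exp 1 * Y / l) ^ l := by
  classical
  have hl' : (0 : ℝ) < l := by exact_mod_cast hl
  set t : ℝ := l / Y with ht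
  have ht0 : 0 < t := div_pos hl' hY
  have h1 : t ^ l * ∑ B ∈ W.powersetCard l, ∏ b ∈ B, w b ≤ Real.exp l := by
    calc t ^ l * ∑ B ∈ W.powersetCard l, ∏ b ∈ B, w b
        = ∑ B ∈ W.powersetCard l, ∏ b ∈ B, t * w b := by
          rw [Finset.mul_sum]
          refine sum_congr rfl fun B hB => ?_
          rw [prod_mul_distrib, prod_const, (mem_powersetCard.1 hB).2]
      _ ≤ ∑ B ∈ W.powerset, ∏ b ∈ B, t * w b := by
          refine sum_le_sum_of_subset_of_nonneg (fun B hB => ?_) fun B _ _ =>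
            prod_nonneg fun b _ => mul_nonneg ht0.le (hw b)
          exact mem_powerset.2 (mem_powersetCard.1 hB).1
      _ = ∏ b ∈ W, (1 + t * w b) := (Finset.prod_one_add W).symm
      _ ≤ ∏ b ∈ W, Real.exp (t * w b) :=
          prod_le_prod (fun b _ => by have := mul_nonneg ht0.le (hw b); linarith)
            fun b _ => by rw [add_comm]; exact Real.add_one_le_exp _
      _ = Real.exp (t * ∑ b ∈ W, w b) := by rw [← Real.exp_sum, Finset.mul_sum]
      _ ≤ Real.exp l := by
          refine Real.exp_le_exp.2 ?_
          calc t * ∑ b ∈ W, w b ≤ t * Y := by gcongr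
            _ = l := by rw [ht]; field_simp
  have h2 : (Real.exp 1 * Y / l) ^ l = Real.exp l / t ^ l := by
    rw [ht, div_pow, div_pow, mul_pow, ← Real.exp_nat_mul, mul_one, div_div_eq_mul_div]
  rw [h2, le_div_iff₀ (pow_pos ht0 l), mul_comm]
  exact h1

section Digraph

variable {n : ℕ} {p q : ℝ}

lemma prod_one_sub_edgeProb_le (hp : p ∈ Set.Icc (0 : ℝ) 1) (hq : q ∈ Set.Icc (0 : ℝ) 1)
    {N : ℕ} (i : Fin n) (S : Finset (Fin n)) (hN : N + 1 ≤ S.card) :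
    ∏ v ∈ S, (1 - edgeProb n p q (i, v)) ≤ (1 - p) ^ N := by
  have h0 : 0 ≤ 1 - p := sub_nonneg.2 hp.2
  have h1 : 1 - p ≤ 1 := by linarith [hp.1]
  rw [prod_one_sub_edgeProb_row]
  split_ifs
  · calc (1 - q) * (1 - p) ^ (S.card - 1) ≤ 1 * (1 - p) ^ (S.card - 1) := by
          have := pow_nonneg h0 (S.card - 1)
          gcongr
          linarith [hq.1]
      _ ≤ (1 - p) ^ N := by
          rw [one_mul]
          exact pow_le_pow_of_le_one h0 h1 (by omega)
  · exact pow_le_pow_of_le_one h0 h1 (by omega)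

/-- The probability of a fixed obstruction to Hall's condition, together with the absence of a
set `S₀` of edges outside the square `W × W`. -/
lemma bernProb_hallObstruction_le (hp : p ∈ Set.Icc (0 : ℝ) 1) (hq : q ∈ Set.Icc (0 : ℝ) 1)
    {S₀ : Finset (Fin n × Fin n)} {W A B : Finset (Fin n)} (hS₀ : Disjoint S₀ (W ×ˢ W))
    (hA : A ⊆ W) (hB : B ⊆ W) (hcard : A.card = B.card + 1) :
    bernProb (edgeProb n p q)
      {E | Disjoint S₀ E ∧ HallObstruction (fun u v => (u, v) ∈ E) W A B} ≤
    (∏ e ∈ S₀, (1 - edgeProb n p q e)) * (((1 - p) ^ (W.card - A.card)) ^ A.card *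
      ∏ b ∈ B, if b ∈ A then A.card * p else (A.card * p) ^ 2) := by
  classical
  have hx := edgeProb_mem (n := n) hp hq
  have h1p : 0 ≤ 1 - p := sub_nonneg.2 hp.2
  let S₁ : Finset (Fin n × Fin n) := A ×ˢ (W \ B)
  let J : Fin n → Finset (Finset (Fin n)) := fun b =>
    (A.erase b).powersetCard (if b ∈ A then 1 else 2)
  let T : Fin n → Finset (Fin n) → Finset (Fin n × Fin n) := fun b s => s ×ˢ {b}
  have hJ : ∀ b, ∀ s ∈ J b, s ⊆ A ∧ b ∉ s := by
    intro b s hs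
    have h := (mem_powersetCard.1 hs).1
    exact ⟨h.trans (erase_subset _ _), fun hb => notMem_erase b A (h hb)⟩
  have hS₁W : S₁ ⊆ W ×ˢ W := product_subset_product hA sdiff_subset
  have hS₀₁ : Disjoint S₀ S₁ := hS₀.mono_right hS₁W
  have hsub : {E | Disjoint S₀ E ∧ HallObstruction (fun u v => (u, v) ∈ E) W A B} ⊆
      {E | Disjoint (S₀ ∪ S₁) E ∧ ∀ b ∈ B, ∃ s ∈ J b, T b s ⊆ E} := by
    rintro E ⟨h0, h⟩
    refine ⟨disjoint_union_left.2 ⟨h0, Finset.disjoint_left.2 ?_⟩, fun b hb => ?_⟩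
    · rintro ⟨a, v⟩ hav
      exact h.not_rel a (mem_product.1 hav).1 v (mem_product.1 hav).2
    · obtain ⟨a, ha, a', ha', hne, hE, hE'⟩ := h.exists_two b hb
      by_cases hbA : b ∈ A
      · obtain ⟨a₁, ha₁, hne₁, hE₁⟩ : ∃ a₁ ∈ A, a₁ ≠ b ∧ (a₁, b) ∈ E := by
          by_cases hab : a = b
          · exact ⟨a', ha', fun h => hne (hab.trans h.symm), hE'⟩
          · exact ⟨a, ha, hab, hE⟩
        refine ⟨{a₁}, ?_, ?_⟩
        · simp [J, hbA, ha₁, hne₁]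
        · simpa [T] using hE₁
      · have hab : ∀ a₁ ∈ A, a₁ ≠ b := fun a₁ h₁ h₂ => hbA (h₂ ▸ h₁)
        refine ⟨{a, a'}, ?_, ?_⟩
        · simp only [J, if_neg hbA, mem_powersetCard, card_pair hne, and_true]
          intro v hv
          rcases mem_insert.1 hv with rfl | hv
          · exact mem_erase.2 ⟨hab _ ha, ha⟩
          · rw [mem_singleton.1 hv]
            exact mem_erase.2 ⟨hab _ ha', ha'⟩
        · rintro ⟨v, b'⟩ hv
          simp only [T, mem_product, mem_insert, mem_singleton] at hv
          obtain ⟨rfl | rfl, rfl⟩ := hv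
          exacts [hE, hE']
  refine (bernProb_mono hx hsub).trans ((bernProb_forall_exists_le hx _ _ _ _ ?_ ?_).trans ?_)
  · intro b hb s hs
    refine disjoint_union_left.2 ⟨hS₀.mono_right ?_, ?_⟩
    · exact product_subset_product ((hJ b s hs).1.trans hA) (singleton_subset_iff.2 (hB hb))
    · refine Finset.disjoint_product.2 (Or.inr ?_)
      simp [hb]
  · intro b _ b' _ hne s _ s' _
    refine Finset.disjoint_product.2 (Or.inr ?_)
    simpa using hne
  · rw [prod_union hS₀₁, mul_assoc]
    have hnn : 0 ≤ ∏ e ∈ S₀, (1 - edgeProb n p q e) :=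
      prod_nonneg fun e _ => sub_nonneg.2 (hx e).2
    refine mul_le_mul_of_nonneg_left (mul_le_mul ?_ ?_ ?_ ?_) hnn
    · rw [prod_product]
      refine (prod_le_prod (fun a _ => prod_nonneg fun v _ => sub_nonneg.2 (hx _).2)
        fun a _ => prod_one_sub_edgeProb_le (N := W.card - A.card) hp hq a _ ?_).trans
        (prod_const _).le
      have h1 := card_sdiff_add_card_eq_card hB
      have h2 := card_le_card hA
      omega
    · refine prod_le_prod (fun b _ => sum_nonneg fun s _ => prod_nonneg fun e _ => (hx e).1)
        fun b _ => ?_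
      have hprod : ∀ s ∈ J b, ∏ e ∈ T b s, edgeProb n p q e = p ^ s.card := by
        intro s hs
        rw [prod_product, ← prod_const]
        refine prod_congr rfl fun v hv => ?_
        rw [prod_singleton, edgeProb, if_neg fun h : v = b => (hJ b s hs).2 (h ▸ hv)]
      have hcardJ : ∀ s ∈ J b, p ^ s.card = p ^ (if b ∈ A then 1 else 2) := fun s hs => by
        rw [(mem_powersetCard.1 hs).2]
      rw [sum_congr rfl hprod, sum_congr rfl hcardJ, sum_const, card_powersetCard, nsmul_eq_mul]
      split_ifs with hbA
      · rw [Nat.choose_one_right, pow_one]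
        have := hp.1
        gcongr
        exact erase_subset _ _
      · rw [mul_pow, Finset.erase_eq_of_notMem hbA]
        have := hp.1
        gcongr
        exact_mod_cast Nat.choose_le_pow _ _
    · exact prod_nonneg fun b _ => sum_nonneg fun s _ => prod_nonneg fun e _ => (hx e).1
    · exact pow_nonneg (pow_nonneg h1p _) _

lemma bernProb_exists_hallObstruction_le (hp : p ∈ Set.Ioc (0 : ℝ) 1)
    (hq : q ∈ Set.Icc (0 : ℝ) 1) {S₀ : Finset (Fin n × Fin n)} {W : Finset (Fin n)}
    (hS₀ : Disjoint S₀ (W ×ˢ W)) :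
    bernProb (edgeProb n p q)
      {E | Disjoint S₀ E ∧ ∃ A B, HallObstruction (fun u v => (u, v) ∈ E) W A B} ≤
    (∏ e ∈ S₀, (1 - edgeProb n p q e)) *
      ∑ l ∈ (Finset.Icc 1 n).filter (fun l => 2 * (l + 1) ≤ W.card + 1),
        (n.choose (l + 1) : ℝ) * (((1 - p) ^ (W.card - (l + 1))) ^ (l + 1) *
          (Real.exp 1 * ((l + 1) * ((l + 1) * p) + n * ((l + 1) * p) ^ 2) / l) ^ l) := by
  classical
  have hp' : p ∈ Set.Icc (0 : ℝ) 1 := ⟨hp.1.le, hp.2⟩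
  have hx := edgeProb_mem (n := n) hp' hq
  have h1p : 0 ≤ 1 - p := sub_nonneg.2 hp.2
  have hnn : 0 ≤ ∏ e ∈ S₀, (1 - edgeProb n p q e) :=
    prod_nonneg fun e _ => sub_nonneg.2 (hx e).2
  rw [Finset.mul_sum]
  refine (bernProb_mono hx (B := {E | ∃ l ∈ (Finset.Icc 1 n).filter
    (fun l => 2 * (l + 1) ≤ W.card + 1), E ∈ {E | ∃ A ∈ W.powersetCard (l + 1),
      E ∈ {E | ∃ B ∈ W.powersetCard l, E ∈ {E | Disjoint S₀ E ∧
        HallObstruction (fun u v => (u, v) ∈ E) W A B}}}}) ?_).trans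
    ((bernProb_biUnion_le hx _ _).trans (sum_le_sum fun l hl => ?_))
  · rintro E ⟨h0, A, B, h⟩
    refine ⟨B.card, ?_, A, mem_powersetCard.2 ⟨h.left_subset, h.card_eq⟩, B,
      mem_powersetCard.2 ⟨h.right_subset, rfl⟩, h0, h⟩
    refine mem_filter.2 ⟨mem_Icc.2 ⟨h.one_le, ?_⟩, ?_⟩
    · simpa using card_le_univ B
    · rw [← h.card_eq]
      exact h.two_mul_le
  · have hl1 : 1 ≤ l := (mem_Icc.1 (mem_filter.1 hl).1).1
    have hAbound : ∀ A ∈ W.powersetCard (l + 1), bernProb (edgeProb n p q)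
        {E | ∃ B ∈ W.powersetCard l, E ∈ {E | Disjoint S₀ E ∧
          HallObstruction (fun u v => (u, v) ∈ E) W A B}} ≤
        (∏ e ∈ S₀, (1 - edgeProb n p q e)) * (((1 - p) ^ (W.card - (l + 1))) ^ (l + 1) *
          (Real.exp 1 * ((l + 1) * ((l + 1) * p) + n * ((l + 1) * p) ^ 2) / l) ^ l) := by
      intro A hA
      obtain ⟨hAW, hAc⟩ := mem_powersetCard.1 hA
      refine (bernProb_biUnion_le hx _ _).trans ((sum_le_sum fun B hB =>
        bernProb_hallObstruction_le hp' hq hS₀ hAW (mem_powersetCard.1 hB).1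
          (by rw [hAc, (mem_powersetCard.1 hB).2])).trans ?_)
      rw [← Finset.mul_sum, ← Finset.mul_sum, hAc]
      refine mul_le_mul_of_nonneg_left (mul_le_mul_of_nonneg_left ?_
        (pow_nonneg (pow_nonneg h1p _) _)) hnn
      have hkp : 0 ≤ ((l + 1 : ℕ) : ℝ) * p := mul_nonneg (Nat.cast_nonneg _) hp.1.le
      refine sum_powersetCard_prod_le W (w := fun b => if b ∈ A then ((l + 1 : ℕ) : ℝ) * p else
        (((l + 1 : ℕ) : ℝ) * p) ^ 2) (fun b => ?_) ?_ ?_ hl1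
      · split_ifs
        exacts [hkp, sq_nonneg _]
      · have := hp.1
        positivity
      · calc ∑ b ∈ W, (if b ∈ A then ((l + 1 : ℕ) : ℝ) * p else (((l + 1 : ℕ) : ℝ) * p) ^ 2)
            ≤ ∑ b ∈ W, ((if b ∈ A then ((l + 1 : ℕ) : ℝ) * p else 0) +
                (((l + 1 : ℕ) : ℝ) * p) ^ 2) := by
              refine sum_le_sum fun b _ => ?_
              have := sq_nonneg (((l + 1 : ℕ) : ℝ) * p)
              split_ifs <;> linarith
          _ ≤ (l + 1) * ((l + 1) * p) + n * ((l + 1) * p) ^ 2 := by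
              rw [sum_add_distrib, Finset.sum_ite_mem, inter_eq_right.2 hAW, sum_const, hAc,
                sum_const, nsmul_eq_mul, nsmul_eq_mul]
              have : (W.card : ℝ) ≤ n := by
                exact_mod_cast (card_le_univ W).trans_eq (Fintype.card_fin n)
              push_cast
              gcongr
    refine (bernProb_biUnion_le hx _ _).trans ((sum_le_sum hAbound).trans ?_)
    rw [sum_const, card_powersetCard, nsmul_eq_mul, mul_left_comm]
    have hl0 : (0 : ℝ) < l := by exact_mod_cast hl1
    have hWn : W.card ≤ n := (card_le_univ W).trans_eq (Fintype.card_fin n)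
    have := hp.1
    refine mul_le_mul_of_nonneg_left (mul_le_mul_of_nonneg_right ?_ (by positivity)) hnn
    exact_mod_cast Nat.choose_le_choose _ hWn

end Digraph

/-- The ratio of the geometric series bounding the expected number of Hall obstructions, as a
function of `t = n * p`. -/
noncomputable def hallRatio (t : ℝ) : ℝ :=
  2 * Real.exp 1 ^ 3 * (t * (1 + t)) * Real.exp (-(t / 2))

lemma pow_one_sub_le_exp {p : ℝ} (hp : p ≤ 1) (N : ℕ) : (1 - p) ^ N ≤ Real.exp (-(p * N)) := by
  calc (1 - p) ^ N ≤ Real.exp (-p) ^ N :=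
        pow_le_pow_left₀ (sub_nonneg.2 hp) (Real.one_sub_le_exp_neg p) N
    _ = Real.exp (-(p * N)) := by rw [← Real.exp_nat_mul]; ring_nf

lemma hallTerm_le {n j m l : ℕ} {p : ℝ} (hp : p ∈ Set.Ioc (0 : ℝ) 1) (hl : 1 ≤ l)
    (hm : m + j = n) (hlm : 2 * (l + 1) ≤ m + 1) (hpj : p * (j + 2) ≤ 1) :
    (n.choose (l + 1) : ℝ) * (((1 - p) ^ (m - (l + 1))) ^ (l + 1) *
      (Real.exp 1 * ((l + 1) * ((l + 1) * p) + n * ((l + 1) * p) ^ 2) / l) ^ l) ≤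
    Real.exp 1 ^ 2 * (n * Real.exp (-(n * p))) * hallRatio (n * p) ^ l := by
  obtain ⟨hp0, hp1⟩ := hp
  have hl0 : (1 : ℝ) ≤ l := by exact_mod_cast hl
  have hl0' : (0 : ℝ) < l := by linarith
  set e : ℝ := Real.exp 1 with he
  have he0 : 0 < e := Real.exp_pos 1
  have hnp : (0 : ℝ) ≤ n * p := by positivity
  have h1 : (n.choose (l + 1) : ℝ) ≤ (n : ℝ) ^ (l + 1) / ((l + 1).factorial : ℝ) :=
    Nat.choose_le_pow_div _ _
  have h2 : ((1 - p) ^ (m - (l + 1))) ^ (l + 1) ≤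
      Real.exp (-(n * p)) * (e * (e * Real.exp (-(n * p / 2))) ^ l) := by
    have hexp : Real.exp (-(n * p)) * (e * (e * Real.exp (-(n * p / 2))) ^ l) =
        Real.exp (-(n * p) + (1 + l * (1 + -(n * p / 2)))) := by
      rw [he, ← Real.exp_add, ← Real.exp_nat_mul, ← Real.exp_add, ← Real.exp_add]
    rw [hexp, ← pow_mul]
    refine (pow_one_sub_le_exp hp1 _).trans (Real.exp_le_exp.2 ?_)
    have hmk : ((m - (l + 1) : ℕ) : ℝ) = n - j - (l + 1) := by
      rw [Nat.cast_sub (by omega), ← hm]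
      push_cast
      ring
    have hln : 2 * (l : ℝ) ≤ n - j - 1 := by
      have : 2 * l + j + 1 ≤ n := by omega
      have : ((2 * l + j + 1 : ℕ) : ℝ) ≤ n := by exact_mod_cast this
      push_cast at this
      linarith
    have hj : (0 : ℝ) ≤ j := Nat.cast_nonneg _
    rw [Nat.cast_mul, hmk]
    push_cast
    have h3 : 0 ≤ p * l * (n - j - 1 - 2 * l) :=
      mul_nonneg (by positivity) (by linarith)
    have h4 : 0 ≤ (l + 1) * (1 - p * (j + 2)) := mul_nonneg (by linarith) (by linarith)
    have h5 : 0 ≤ p * l * (j + 1) := by positivity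
    nlinarith
  have h3 : (e * ((l + 1) * ((l + 1) * p) + n * ((l + 1) * p) ^ 2) / l) ^ l ≤
      (2 * e * (p * (1 + n * p))) ^ l * (l + 1 : ℝ) ^ l := by
    rw [← mul_pow]
    refine pow_le_pow_left₀ (by positivity) ?_ _
    rw [div_le_iff₀ hl0']
    have : (l + 1 : ℝ) * (l + 1) ≤ 2 * (l + 1) * l := by nlinarith
    calc e * ((l + 1) * ((l + 1) * p) + n * ((l + 1) * p) ^ 2)
        = e * (p * (1 + n * p)) * ((l + 1) * (l + 1)) := by ring
      _ ≤ e * (p * (1 + n * p)) * (2 * (l + 1) * l) := by gcongr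
      _ = _ := by ring
  have h4 : (l + 1 : ℝ) ^ l / ((l + 1).factorial : ℝ) ≤ e ^ (l + 1) := by
    have h5 := Real.pow_div_factorial_le_exp ((l + 1 : ℕ) : ℝ) (Nat.cast_nonneg _) (l + 1)
    rw [he, ← Real.exp_nat_mul, mul_one]
    refine le_trans ?_ h5
    push_cast
    gcongr
    · linarith
    · omega
  have h1p : 0 ≤ 1 - p := by linarith
  calc (n.choose (l + 1) : ℝ) * (((1 - p) ^ (m - (l + 1))) ^ (l + 1) *
      (e * ((l + 1) * ((l + 1) * p) + n * ((l + 1) * p) ^ 2) / l) ^ l)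
      ≤ (n : ℝ) ^ (l + 1) / ((l + 1).factorial : ℝ) *
        ((Real.exp (-(n * p)) * (e * (e * Real.exp (-(n * p / 2))) ^ l)) *
          ((2 * e * (p * (1 + n * p))) ^ l * (l + 1 : ℝ) ^ l)) := by gcongr
    _ = (n : ℝ) ^ (l + 1) * ((Real.exp (-(n * p)) * (e * (e * Real.exp (-(n * p / 2))) ^ l)) *
          (2 * e * (p * (1 + n * p))) ^ l) *
          ((l + 1 : ℝ) ^ l / ((l + 1).factorial : ℝ)) := by ring
    _ ≤ (n : ℝ) ^ (l + 1) * ((Real.exp (-(n * p)) * (e * (e * Real.exp (-(n * p / 2))) ^ l)) *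
          (2 * e * (p * (1 + n * p))) ^ l) * e ^ (l + 1) := by gcongr
    _ = e ^ 2 * (n * Real.exp (-(n * p))) * hallRatio (n * p) ^ l := by
      have hx : hallRatio (n * p) =
          n * (e * Real.exp (-(n * p / 2))) * (2 * e * (p * (1 + n * p))) * e := by
        rw [hallRatio]
        ring
      rw [hx]
      generalize 1 + (n : ℝ) * p = w
      generalize Real.exp (-(n * p / 2)) = y
      ring

lemma sum_geom_le {x : ℝ} (hx0 : 0 ≤ x) (hx : x ≤ 1 / 2) {I : Finset ℕ}
    (hI : ∀ l ∈ I, 1 ≤ l) : ∑ l ∈ I, x ^ l ≤ 2 * x := by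
  have h1 : ∀ N : ℕ, ∑ l ∈ Finset.range N, x ^ (l + 1) ≤ 2 * x - 2 * x ^ (N + 1) := by
    intro N
    induction N with
    | zero => simp
    | succ N ih =>
      rw [sum_range_succ, pow_succ x (N + 1)]
      have := mul_le_mul_of_nonneg_left hx (pow_nonneg hx0 (N + 1))
      linarith
  obtain ⟨N, hN⟩ := I.exists_nat_subset_range
  have h2 : I ⊆ (Finset.range N).image (· + 1) := fun l hl => by
    have := hI l hl
    have := mem_range.1 (hN hl)
    exact mem_image.2 ⟨l - 1, mem_range.2 (by omega), by omega⟩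
  calc ∑ l ∈ I, x ^ l ≤ ∑ l ∈ (Finset.range N).image (· + 1), x ^ l :=
        sum_le_sum_of_subset_of_nonneg h2 fun _ _ _ => pow_nonneg hx0 _
    _ = ∑ l ∈ Finset.range N, x ^ (l + 1) :=
        sum_image fun a _ b _ h => Nat.succ_injective h
    _ ≤ 2 * x := (h1 N).trans (by have := pow_nonneg hx0 (N + 1); linarith)

section Digraph

variable {n : ℕ} {p q : ℝ}

lemma bernProb_exists_hallObstruction_le_hallRatio (hp : p ∈ Set.Ioc (0 : ℝ) 1)
    (hq : q ∈ Set.Icc (0 : ℝ) 1) {S₀ : Finset (Fin n × Fin n)} {U : Finset (Fin n)}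
    (hS₀ : Disjoint S₀ ((Finset.univ \ U) ×ˢ (Finset.univ \ U)))
    (hpU : p * (U.card + 2) ≤ 1) (hx : hallRatio (n * p) ≤ 1 / 2) :
    bernProb (edgeProb n p q)
      {E | Disjoint S₀ E ∧
        ∃ A B, HallObstruction (fun u v => (u, v) ∈ E) (Finset.univ \ U) A B} ≤
    (∏ e ∈ S₀, (1 - edgeProb n p q e)) *
      (Real.exp 1 ^ 2 * (n * Real.exp (-(n * p))) * (2 * hallRatio (n * p))) := by
  refine (bernProb_exists_hallObstruction_le hp hq hS₀).trans (mul_le_mul_of_nonneg_left ?_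
    (prod_nonneg fun e _ => sub_nonneg.2 (edgeProb_mem ⟨hp.1.le, hp.2⟩ hq e).2))
  have hU : (Finset.univ \ U).card + U.card = n := by
    rw [card_sdiff_add_card_eq_card (subset_univ U), card_univ, Fintype.card_fin]
  have hx0 : 0 ≤ hallRatio (n * p) := by
    have := hp.1
    unfold hallRatio
    positivity
  calc _ ≤ ∑ l ∈ (Finset.Icc 1 n).filter (fun l => 2 * (l + 1) ≤ (Finset.univ \ U).card + 1),
        Real.exp 1 ^ 2 * (n * Real.exp (-(n * p))) * hallRatio (n * p) ^ l :=
      sum_le_sum fun l hl => hallTerm_le hp (mem_Icc.1 (mem_filter.1 hl).1).1 hU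
        (mem_filter.1 hl).2 hpU
    _ ≤ _ := by
      rw [← Finset.mul_sum]
      exact mul_le_mul_of_nonneg_left
        (sum_geom_le hx0 hx fun l hl => (mem_Icc.1 (mem_filter.1 hl).1).1) (by positivity)

lemma prod_one_sub_edgeProb_rows (U : Finset (Fin n)) :
    ∏ e ∈ U ×ˢ Finset.univ, (1 - edgeProb n p q e) = emptyRowProb n p q ^ U.card := by
  rw [prod_product, ← prod_const]
  exact prod_congr rfl fun i _ => prod_one_sub_edgeProb_univ i

lemma prod_one_sub_edgeProb_cols (U : Finset (Fin n)) :
    ∏ e ∈ Finset.univ ×ˢ U, (1 - edgeProb n p q e) = emptyRowProb n p q ^ U.card := by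
  rw [prod_product_right, ← prod_const]
  refine prod_congr rfl fun i _ => ?_
  rw [← prod_one_sub_edgeProb_univ i]
  exact prod_congr rfl fun v _ => by rw [← edgeProb_prodComm]; rfl

lemma emptyRowProb_nonneg (hp : p ∈ Set.Icc (0 : ℝ) 1) (hq : q ∈ Set.Icc (0 : ℝ) 1) :
    0 ≤ emptyRowProb n p q :=
  mul_nonneg (sub_nonneg.2 hq.2) (pow_nonneg (sub_nonneg.2 hp.2) _)

lemma bernProb_row_subset_le (hp : p ∈ Set.Icc (0 : ℝ) 1) (hq : q ∈ Set.Icc (0 : ℝ) 1)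
    {U : Finset (Fin n)} {a u : Fin n} (haU : a ∉ U) (hu : u ∈ U) :
    bernProb (edgeProb n p q) {E | Disjoint (U ×ˢ Finset.univ ∪ {a} ×ˢ (Finset.univ \ U)) E ∧
      {(a, u)} ⊆ E} ≤ emptyRowProb n p q ^ U.card * (p * (1 - p) ^ (n - U.card - 1)) := by
  have hau : a ≠ u := fun h => haU (h ▸ hu)
  rw [bernProb_cylinder (by simp [haU, hu]), prod_union, prod_one_sub_edgeProb_rows,
    prod_singleton, mul_assoc]
  · refine mul_le_mul_of_nonneg_left ?_ (pow_nonneg (emptyRowProb_nonneg hp hq) _)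
    rw [edgeProb, if_neg hau, mul_comm]
    refine mul_le_mul_of_nonneg_left ?_ hp.1
    rw [prod_product, prod_singleton]
    refine prod_one_sub_edgeProb_le hp hq _ _ ?_
    have h1 := card_sdiff_add_card_eq_card (subset_univ U)
    rw [card_univ, Fintype.card_fin] at h1
    have h2 : 0 < (Finset.univ \ U).card := card_pos.2 ⟨a, by simpa using haU⟩
    omega
  · exact Finset.disjoint_product.2 (Or.inl (by simpa using haU))

/-- The probability that the vertices of `U` have no out-edges, and some other vertex has
out-edges, all of them ending in `U`. -/
lemma bernProb_exists_row_subset_le (hp : p ∈ Set.Icc (0 : ℝ) 1) (hq : q ∈ Set.Icc (0 : ℝ) 1)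
    (U : Finset (Fin n)) :
    bernProb (edgeProb n p q)
      {E | Disjoint (U ×ˢ Finset.univ) E ∧
        ∃ a ∉ U, (∃ u ∈ U, (a, u) ∈ E) ∧ ∀ v ∉ U, (a, v) ∉ E} ≤
    emptyRowProb n p q ^ U.card * (n * (U.card * (p * (1 - p) ^ (n - U.card - 1)))) := by
  have hx := edgeProb_mem (n := n) hp hq
  let C : Fin n → Fin n → Set (Finset (Fin n × Fin n)) := fun a u =>
    {E | Disjoint (U ×ˢ Finset.univ ∪ {a} ×ˢ (Finset.univ \ U)) E ∧ {(a, u)} ⊆ E}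
  have hsub : {E : Finset (Fin n × Fin n) | Disjoint (U ×ˢ Finset.univ) E ∧
      ∃ a ∉ U, (∃ u ∈ U, (a, u) ∈ E) ∧ ∀ v ∉ U, (a, v) ∉ E} ⊆
      {E | ∃ a ∈ Finset.univ \ U, E ∈ {E | ∃ u ∈ U, E ∈ C a u}} := by
    rintro E ⟨h0, a, ha, ⟨u, hu, hau⟩, hav⟩
    refine ⟨a, mem_sdiff.2 ⟨mem_univ _, ha⟩, u, hu,
      disjoint_union_left.2 ⟨h0, Finset.disjoint_left.2 ?_⟩, singleton_subset_iff.2 hau⟩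
    rintro ⟨a', v⟩ h
    obtain ⟨h1, h2⟩ := mem_product.1 h
    rw [show a' = a from mem_singleton.1 h1]
    exact hav v (mem_sdiff.1 h2).2
  refine (bernProb_mono hx hsub).trans
    ((bernProb_biUnion_le hx _ fun a => {E | ∃ u ∈ U, E ∈ C a u}).trans ?_)
  have hone : ∀ a ∈ Finset.univ \ U, bernProb (edgeProb n p q) {E | ∃ u ∈ U, E ∈ C a u} ≤
      U.card * (emptyRowProb n p q ^ U.card * (p * (1 - p) ^ (n - U.card - 1))) := by
    intro a ha
    have haU : a ∉ U := (mem_sdiff.1 ha).2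
    refine (bernProb_biUnion_le hx _ (C a)).trans ((sum_le_sum fun u hu => ?_).trans_eq
      ((sum_const _).trans (nsmul_eq_mul _ _)))
    exact bernProb_row_subset_le hp hq haU hu
  refine (sum_le_sum hone).trans ?_
  rw [sum_const, nsmul_eq_mul]
  have hc : ((Finset.univ \ U).card : ℝ) ≤ n := by
    exact_mod_cast (card_le_univ _).trans_eq (Fintype.card_fin n)
  have h1 := pow_nonneg (emptyRowProb_nonneg (n := n) hp hq) U.card
  have h2 := mul_nonneg hp.1 (pow_nonneg (sub_nonneg.2 hp.2) (n - U.card - 1))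
  refine (mul_le_mul_of_nonneg_right hc
    (mul_nonneg (Nat.cast_nonneg _) (mul_nonneg h1 h2))).trans_eq ?_
  rw [mul_left_comm (U.card : ℝ), mul_left_comm (n : ℝ)]

lemma bernProb_many_empty_rows_le (hp : p ∈ Set.Icc (0 : ℝ) 1) (hq : q ∈ Set.Icc (0 : ℝ) 1)
    (K : ℕ) :
    bernProb (edgeProb n p q)
      {E | ∃ U : Finset (Fin n), K < U.card ∧ Disjoint (U ×ˢ Finset.univ) E} ≤
    (n * emptyRowProb n p q) ^ (K + 1) / (K + 1).factorial := by
  classical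
  have hx := edgeProb_mem (n := n) hp hq
  refine (bernProb_mono hx (B := {E | ∃ U ∈ Finset.univ.powersetCard (K + 1),
    E ∈ {E | Disjoint (U ×ˢ Finset.univ) E ∧ ∅ ⊆ E}}) ?_).trans
    ((bernProb_biUnion_le hx _ _).trans ?_)
  · rintro E ⟨U, hU, hE⟩
    obtain ⟨U', h1, h2⟩ := exists_subset_card_eq (Nat.succ_le_of_lt hU)
    exact ⟨U', mem_powersetCard.2 ⟨subset_univ _, h2⟩,
      hE.mono_left (product_subset_product_left h1), empty_subset _⟩
  · have h1 : ∀ U ∈ (Finset.univ : Finset (Fin n)).powersetCard (K + 1),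
        bernProb (edgeProb n p q) {E | Disjoint (U ×ˢ Finset.univ) E ∧ ∅ ⊆ E} =
        emptyRowProb n p q ^ (K + 1) := by
      intro U hU
      rw [bernProb_cylinder (disjoint_empty_right _), prod_one_sub_edgeProb_rows, prod_empty,
        mul_one, (mem_powersetCard.1 hU).2]
    rw [sum_congr rfl h1, sum_const, card_powersetCard, nsmul_eq_mul, card_univ,
      Fintype.card_fin, mul_pow, mul_div_right_comm]
    exact mul_le_mul_of_nonneg_right (Nat.choose_le_pow_div _ _)
      (pow_nonneg (emptyRowProb_nonneg hp hq) _)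


/-- The error term, per set of at most `K` empty rows, in the bound for the probability that there
is no row factor. -/
noncomputable def rowFactorError (K n : ℕ) (p : ℝ) : ℝ :=
  K * (n * p * (Real.exp 1 * Real.exp (-(n * p)))) +
    2 * (Real.exp 1 ^ 2 * (n * Real.exp (-(n * p))) * (2 * hallRatio (n * p)))

lemma bernProb_flip_hallObstruction (U : Finset (Fin n)) :
    bernProb (edgeProb n p q) {E | Disjoint (U ×ˢ Finset.univ) E ∧
      ∃ A B, HallObstruction (flip fun u v => (u, v) ∈ E) (Finset.univ \ U) A B} =
    bernProb (edgeProb n p q) {E | Disjoint (Finset.univ ×ˢ U) E ∧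
      ∃ A B, HallObstruction (fun u v => (u, v) ∈ E) (Finset.univ \ U) A B} := by
  refine Eq.trans ?_ (bernProb_map (Equiv.prodComm (Fin n) (Fin n)) edgeProb_prodComm _)
  congr 1
  ext E
  have hmem : ∀ u v, (u, v) ∈ E.map (Equiv.prodComm (Fin n) (Fin n)).toEmbedding ↔
      (v, u) ∈ E := by
    intro u v
    simp [Finset.mem_map_equiv]
  have hrel : (fun u v => (u, v) ∈ E.map (Equiv.prodComm (Fin n) (Fin n)).toEmbedding) =
      flip fun u v => (u, v) ∈ E :=
    funext fun u => funext fun v => propext (hmem u v)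
  have hdisj : Disjoint (Finset.univ ×ˢ U) (E.map (Equiv.prodComm (Fin n) (Fin n)).toEmbedding) ↔
      Disjoint (U ×ˢ Finset.univ) E := by
    simp only [Finset.disjoint_left, Prod.forall, mem_product, Finset.mem_univ, true_and, and_true,
      hmem]
    exact forall_comm
  rw [Set.mem_ofPred_eq, Set.mem_ofPred_eq, Set.mem_ofPred_eq, hrel, hdisj]

lemma bernProb_failure_le (hp : p ∈ Set.Ioc (0 : ℝ) 1) (hq : q ∈ Set.Icc (0 : ℝ) 1) {K : ℕ}
    (hpK : p * (K + 2) ≤ 1) (hx : hallRatio (n * p) ≤ 1 / 2) {U : Finset (Fin n)}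
    (hU : U.card ≤ K) :
    bernProb (edgeProb n p q)
      (({E | Disjoint (U ×ˢ Finset.univ) E ∧
        ∃ a ∉ U, (∃ u ∈ U, (a, u) ∈ E) ∧ ∀ v ∉ U, (a, v) ∉ E} ∪
      {E | Disjoint (U ×ˢ Finset.univ) E ∧
        ∃ A B, HallObstruction (fun u v => (u, v) ∈ E) (Finset.univ \ U) A B}) ∪
      {E | Disjoint (U ×ˢ Finset.univ) E ∧
        ∃ A B, HallObstruction (flip fun u v => (u, v) ∈ E) (Finset.univ \ U) A B}) ≤
    emptyRowProb n p q ^ U.card * rowFactorError K n p := by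
  have hp' : p ∈ Set.Icc (0 : ℝ) 1 := ⟨hp.1.le, hp.2⟩
  have hUK : (U.card : ℝ) ≤ K := Nat.cast_le.2 hU
  have hpU : p * (U.card + 2) ≤ 1 :=
    (mul_le_mul_of_nonneg_left (by linarith) hp.1.le).trans hpK
  have hr := pow_nonneg (emptyRowProb_nonneg (n := n) hp' hq) U.card
  have hd1 : Disjoint (U ×ˢ Finset.univ) ((Finset.univ \ U) ×ˢ (Finset.univ \ U)) :=
    Finset.disjoint_product.2 (Or.inl disjoint_sdiff)
  have hd2 : Disjoint (Finset.univ ×ˢ U) ((Finset.univ \ U) ×ˢ (Finset.univ \ U)) :=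
    Finset.disjoint_product.2 (Or.inr disjoint_sdiff)
  have h1 := bernProb_exists_row_subset_le hp' hq U
  have h2 := bernProb_exists_hallObstruction_le_hallRatio hp hq hd1 hpU hx
  have h3 := bernProb_exists_hallObstruction_le_hallRatio hp hq hd2 hpU hx
  rw [prod_one_sub_edgeProb_rows] at h2
  rw [prod_one_sub_edgeProb_cols, ← bernProb_flip_hallObstruction] at h3
  have h4 : (1 - p) ^ (n - U.card - 1) ≤ Real.exp 1 * Real.exp (-(n * p)) := by
    rw [← Real.exp_add]
    refine (pow_one_sub_le_exp hp.2 _).trans (Real.exp_le_exp.2 ?_)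
    have h5 : (n : ℝ) ≤ ((n - U.card - 1 : ℕ) : ℝ) + (U.card + 1) := by
      exact_mod_cast (by omega : n ≤ (n - U.card - 1) + (U.card + 1))
    nlinarith [mul_le_mul_of_nonneg_left h5 hp.1.le, hp.1]
  have h6 : (n : ℝ) * (U.card * (p * (1 - p) ^ (n - U.card - 1))) ≤
      K * (n * p * (Real.exp 1 * Real.exp (-(n * p)))) := by
    calc (n : ℝ) * (U.card * (p * (1 - p) ^ (n - U.card - 1))) =
        U.card * (n * p * (1 - p) ^ (n - U.card - 1)) := by ring
      _ ≤ _ := mul_le_mul hUK (mul_le_mul_of_nonneg_left h4 (by have := hp.1; positivity))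
          (mul_nonneg (by have := hp.1; positivity) (pow_nonneg (sub_nonneg.2 hp.2) _))
          (Nat.cast_nonneg _)
  have h7 := mul_le_mul_of_nonneg_left h6 hr
  have hx' := edgeProb_mem (n := n) hp' hq
  refine (bernProb_union_le hx' _ _).trans
    ((add_le_add_left (bernProb_union_le hx' _ _) _).trans ?_)
  rw [rowFactorError, mul_add]
  linarith

/-- If no column is empty and there is no row factor, then one of three obstructions to finding
a cycle factor on the set of non-empty rows occurs. -/
lemma exists_failure_of_not_hasRowFactor {E : Finset (Fin n × Fin n)}
    (hcol : ∀ v, ∃ i, (i, v) ∈ E) (hE : ¬ HasRowFactor n E) :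
    ∃ U : Finset (Fin n), Disjoint (U ×ˢ Finset.univ) E ∧
      ((∃ a ∉ U, (∃ u ∈ U, (a, u) ∈ E) ∧ ∀ v ∉ U, (a, v) ∉ E) ∨
      (∃ A B, HallObstruction (fun u v => (u, v) ∈ E) (Finset.univ \ U) A B) ∨
      ∃ A B, HallObstruction (flip fun u v => (u, v) ∈ E) (Finset.univ \ U) A B) := by
  have hU : ∃ U : Finset (Fin n), ∀ u, u ∈ U ↔ ∀ v, (u, v) ∉ E := by
    classical exact ⟨Finset.univ.filter fun u => ∀ v, (u, v) ∉ E, fun u => by simp⟩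
  obtain ⟨U, hU⟩ := hU
  refine ⟨U, Finset.disjoint_left.2 fun e he => (hU e.1).1 (mem_product.1 he).1 e.2, ?_⟩
  by_cases hbad : ∃ a ∉ U, (∃ u ∈ U, (a, u) ∈ E) ∧ ∀ v ∉ U, (a, v) ∉ E
  · exact Or.inl hbad
  have hrow : ∀ u ∈ Finset.univ \ U, ∃ v ∈ Finset.univ \ U, (u, v) ∈ E := by
    intro u hu
    have hu' := (mem_sdiff.1 hu).2
    by_contra! h
    have hne := hu'
    rw [hU] at hne
    push Not at hne
    obtain ⟨v, hv⟩ := hne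
    have hvU : v ∈ U := by
      by_contra hvU
      exact h v (mem_sdiff.2 ⟨mem_univ _, hvU⟩) hv
    exact hbad ⟨u, hu', ⟨v, hvU, hv⟩, fun w hw => h w (mem_sdiff.2 ⟨mem_univ _, hw⟩)⟩
  have hcol' : ∀ v ∈ Finset.univ \ U, ∃ u ∈ Finset.univ \ U, (u, v) ∈ E := by
    intro v _
    obtain ⟨i, hi⟩ := hcol v
    exact ⟨i, mem_sdiff.2 ⟨mem_univ _, fun h => (hU i).1 h v hi⟩, hi⟩
  rcases exists_perm_or_hallObstruction (fun u v => (u, v) ∈ E) _ hrow hcol' with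
    ⟨σ, hσ⟩ | ⟨A, B, h | h⟩
  · refine absurd ⟨σ, Finset.univ \ U, fun u hu => (hσ u hu).1, fun u hu => (hσ u hu).2,
      fun e he => mem_sdiff.2 ⟨mem_univ _, fun h => (hU e.1).1 h e.2 he⟩⟩ hE
  · exact Or.inr (Or.inl ⟨A, B, h⟩)
  · exact Or.inr (Or.inr ⟨A, B, h⟩)

lemma rowFactorError_nonneg (K n : ℕ) (hp : 0 ≤ p) : 0 ≤ rowFactorError K n p := by
  unfold rowFactorError hallRatio
  positivity

lemma bernProb_cols_nonempty_not_hasRowFactor_le (hp : p ∈ Set.Ioc (0 : ℝ) 1)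
    (hq : q ∈ Set.Icc (0 : ℝ) 1) {K : ℕ} (hpK : p * (K + 2) ≤ 1)
    (hx : hallRatio (n * p) ≤ 1 / 2) :
    bernProb (edgeProb n p q) {E | (∀ v, ∃ i, (i, v) ∈ E) ∧ ¬ HasRowFactor n E} ≤
    (n * emptyRowProb n p q) ^ (K + 1) / (K + 1).factorial +
      (1 + emptyRowProb n p q) ^ n * rowFactorError K n p := by
  have hp' : p ∈ Set.Icc (0 : ℝ) 1 := ⟨hp.1.le, hp.2⟩
  have hx' := edgeProb_mem (n := n) hp' hq
  let C : Finset (Fin n) → Set (Finset (Fin n × Fin n)) := fun U =>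
    ({E | Disjoint (U ×ˢ Finset.univ) E ∧
        ∃ a ∉ U, (∃ u ∈ U, (a, u) ∈ E) ∧ ∀ v ∉ U, (a, v) ∉ E} ∪
      {E | Disjoint (U ×ˢ Finset.univ) E ∧
        ∃ A B, HallObstruction (fun u v => (u, v) ∈ E) (Finset.univ \ U) A B}) ∪
      {E | Disjoint (U ×ˢ Finset.univ) E ∧
        ∃ A B, HallObstruction (flip fun u v => (u, v) ∈ E) (Finset.univ \ U) A B}
  let I : Finset (Finset (Fin n)) := {U | U.card ≤ K}
  have hsub : {E : Finset (Fin n × Fin n) | (∀ v, ∃ i, (i, v) ∈ E) ∧ ¬ HasRowFactor n E} ⊆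
      {E | ∃ U : Finset (Fin n), K < U.card ∧ Disjoint (U ×ˢ Finset.univ) E} ∪
      {E | ∃ U ∈ I, E ∈ C U} := by
    rintro E ⟨hcol, hE⟩
    obtain ⟨U, hU, h⟩ := exists_failure_of_not_hasRowFactor hcol hE
    rcases lt_or_ge K U.card with hK | hK
    · exact Or.inl ⟨U, hK, hU⟩
    · refine Or.inr ⟨U, mem_filter.2 ⟨mem_univ _, hK⟩, ?_⟩
      rcases h with h | h | h
      · exact Or.inl (Or.inl ⟨hU, h⟩)
      · exact Or.inl (Or.inr ⟨hU, h⟩)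
      · exact Or.inr ⟨hU, h⟩
  refine (bernProb_mono hx' hsub).trans ((bernProb_union_le hx' _ _).trans
    (add_le_add (bernProb_many_empty_rows_le hp' hq K)
      ((bernProb_biUnion_le hx' I C).trans ?_)))
  have hD := rowFactorError_nonneg K n hp.1.le
  have hr := emptyRowProb_nonneg (n := n) hp' hq
  calc ∑ U ∈ I, bernProb (edgeProb n p q) (C U)
      ≤ ∑ U ∈ I, emptyRowProb n p q ^ U.card * rowFactorError K n p :=
        sum_le_sum fun U hU => bernProb_failure_le hp hq hpK hx (mem_filter.1 hU).2
    _ ≤ ∑ U : Finset (Fin n), emptyRowProb n p q ^ U.card * rowFactorError K n p :=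
        sum_le_sum_of_subset_of_nonneg (subset_univ _) fun U _ _ =>
          mul_nonneg (pow_nonneg hr _) hD
    _ = (1 + emptyRowProb n p q) ^ n * rowFactorError K n p := by
        have h := Fintype.sum_pow_mul_eq_add_pow (Fin n) (emptyRowProb n p q) 1
        simp only [one_pow, mul_one, Fintype.card_fin] at h
        rw [← sum_mul, h, add_comm]

lemma bernProb_le_one (hp : p ∈ Set.Icc (0 : ℝ) 1) (hq : q ∈ Set.Icc (0 : ℝ) 1)
    (A : Set (Finset (Fin n × Fin n))) : bernProb (edgeProb n p q) A ≤ 1 := by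
  refine (bernProb_mono (edgeProb_mem hp hq) (B := {E | Disjoint ∅ E ∧ ∅ ⊆ E})
    (fun E _ => ⟨disjoint_empty_left E, empty_subset E⟩)).trans_eq
      ((bernProb_cylinder (disjoint_empty_left ∅)).trans ?_)
  simp

/-- The probability of structural diagonalizability is bounded below using the union of the events
that all rows, respectively all columns, are non-empty. -/
lemma le_digraphProb_structurallyDiagonalizable (hp : p ∈ Set.Ioc (0 : ℝ) 1)
    (hq : q ∈ Set.Icc (0 : ℝ) 1) {K : ℕ} (hpK : p * (K + 2) ≤ 1)
    (hx : hallRatio (n * p) ≤ 1 / 2) (m : ℕ) :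
    2 * (1 - emptyRowProb n p q) ^ n -
      (∑ s ∈ range (2 * m + 1), (-1) ^ s * (n.choose s * emptyColsProb n s p q)) -
      2 * ((n * emptyRowProb n p q) ^ (K + 1) / (K + 1).factorial +
        (1 + emptyRowProb n p q) ^ n * rowFactorError K n p) ≤
    digraphProb n p q {E | StructurallyDiagonalizable n E} := by
  have hp' : p ∈ Set.Icc (0 : ℝ) 1 := ⟨hp.1.le, hp.2⟩
  have hx' := edgeProb_mem (n := n) hp' hq
  let F : Set (Finset (Fin n × Fin n)) := {E | (∀ v, ∃ i, (i, v) ∈ E) ∧ ¬ HasRowFactor n E}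
  let F' : Set (Finset (Fin n × Fin n)) :=
    {E | E.map (Equiv.prodComm (Fin n) (Fin n)).toEmbedding ∈ F}
  have hF : bernProb (edgeProb n p q) F' = bernProb (edgeProb n p q) F :=
    bernProb_map (Equiv.prodComm (Fin n) (Fin n)) edgeProb_prodComm F
  have hF2 := bernProb_cols_nonempty_not_hasRowFactor_le (n := n) hp hq hpK hx
  have hsub : {E : Finset (Fin n × Fin n) | ∀ i, ∃ v, (i, v) ∈ E} ∪
      {E | ∀ v, ∃ i, (i, v) ∈ E} ⊆ {E | StructurallyDiagonalizable n E} ∪ (F ∪ F') := by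
    rintro E (h | h)
    · by_cases hE : HasRowFactor n (E.map (Equiv.prodComm _ _).toEmbedding)
      · exact Or.inl hE.structurallyDiagonalizable_of_swap
      · refine Or.inr (Or.inr ⟨fun v => ?_, hE⟩)
        obtain ⟨w, hw⟩ := h v
        exact ⟨w, Finset.mem_map_equiv.2 hw⟩
    · by_cases hE : HasRowFactor n E
      · exact Or.inl hE.structurallyDiagonalizable
      · exact Or.inr (Or.inl ⟨h, hE⟩)
  have h1 := bernProb_mono hx' hsub
  have h2 := bernProb_union_le hx' {E | StructurallyDiagonalizable n E} (F ∪ F')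
  have h3 := bernProb_union_le hx' F F'
  have h4 := bernProb_union_add_inter (x := edgeProb n p q)
    {E : Finset (Fin n × Fin n) | ∀ i, ∃ v, (i, v) ∈ E} {E | ∀ v, ∃ i, (i, v) ∈ E}
  have h5 := bernProb_rows_nonempty_cols_nonempty_le (n := n) hp' hq m
  rw [bernProb_rows_nonempty, bernProb_cols_nonempty] at h4
  rw [digraphProb_eq_bernProb]
  have hF3 : bernProb (edgeProb n p q) F ≤ _ := hF2
  linarith

end Digraph

section Asymptotics

variable {c q : ℝ} {p : ℕ → ℝ}

lemma tendsto_mul_atTop_of_sub_log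
    (hlim : Tendsto (fun n : ℕ => (n : ℝ) * p n - Real.log n) atTop (nhds c)) :
    Tendsto (fun n : ℕ => (n : ℝ) * p n) atTop atTop :=
  (hlim.add_atTop (Real.tendsto_log_atTop.comp tendsto_natCast_atTop_atTop)).congr fun n => by
    simp

lemma tendsto_mul_exp_neg_of_sub_log
    (hlim : Tendsto (fun n : ℕ => (n : ℝ) * p n - Real.log n) atTop (nhds c)) :
    Tendsto (fun n : ℕ => (n : ℝ) * Real.exp (-(n * p n))) atTop (nhds (Real.exp (-c))) := by
  refine ((Real.continuous_exp.tendsto _).comp hlim.neg).congr' ?_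
  filter_upwards [eventually_gt_atTop 0] with n hn
  have hn' : (0 : ℝ) < n := Nat.cast_pos.2 hn
  rw [Function.comp_apply, neg_sub, sub_eq_add_neg, Real.exp_add, Real.exp_log hn']

lemma tendsto_mul_mul_exp_neg_of_sub_log
    (hlim : Tendsto (fun n : ℕ => (n : ℝ) * p n - Real.log n) atTop (nhds c)) (k : ℕ) :
    Tendsto (fun n : ℕ => ((n : ℝ) * p n) ^ k * Real.exp (-(n * p n))) atTop (nhds 0) :=
  (Real.tendsto_pow_mul_exp_neg_atTop_nhds_zero k).comp (tendsto_mul_atTop_of_sub_log hlim)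

lemma tendsto_mul_pow_succ_of_sub_log
    (hlim : Tendsto (fun n : ℕ => (n : ℝ) * p n - Real.log n) atTop (nhds c)) (k : ℕ) :
    Tendsto (fun n : ℕ => (n : ℝ) ^ k * p n ^ (k + 1)) atTop (nhds 0) := by
  have h := (tendsto_mul_mul_exp_neg_of_sub_log hlim (k + 1)).div
    (tendsto_mul_exp_neg_of_sub_log hlim) (Real.exp_ne_zero _)
  rw [zero_div] at h
  refine h.congr' ?_
  filter_upwards [eventually_gt_atTop 0] with n hn
  have hn' : (n : ℝ) ≠ 0 := Nat.cast_ne_zero.2 hn.ne'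
  have := Real.exp_ne_zero (-(n * p n))
  simp only [Pi.div_apply]
  field_simp
  ring

lemma tendsto_zero_of_sub_log
    (hlim : Tendsto (fun n : ℕ => (n : ℝ) * p n - Real.log n) atTop (nhds c)) :
    Tendsto p atTop (nhds 0) :=
  (tendsto_mul_pow_succ_of_sub_log hlim 0).congr fun n => by simp

lemma tendsto_hallRatio : Tendsto hallRatio atTop (nhds 0) := by
  have h2 : Tendsto (fun t : ℝ => t / 2) atTop atTop := tendsto_id.atTop_div_const two_pos
  have h := (((Real.tendsto_pow_mul_exp_neg_atTop_nhds_zero 1).comp h2).const_mul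
    (4 * Real.exp 1 ^ 3)).add
    (((Real.tendsto_pow_mul_exp_neg_atTop_nhds_zero 2).comp h2).const_mul (8 * Real.exp 1 ^ 3))
  simp only [mul_zero, add_zero] at h
  refine h.congr fun t => ?_
  simp only [Function.comp_apply, hallRatio]
  ring

lemma tendsto_rowFactorError
    (hlim : Tendsto (fun n : ℕ => (n : ℝ) * p n - Real.log n) atTop (nhds c)) (K : ℕ) :
    Tendsto (fun n => rowFactorError K n (p n)) atTop (nhds 0) := by
  have h1 := (tendsto_mul_mul_exp_neg_of_sub_log hlim 1).const_mul (K * Real.exp 1)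
  have h2 := ((tendsto_mul_exp_neg_of_sub_log hlim).mul
    (tendsto_hallRatio.comp (tendsto_mul_atTop_of_sub_log hlim))).const_mul (4 * Real.exp 1 ^ 2)
  have h := h1.add h2
  simp only [mul_zero, add_zero] at h
  refine h.congr fun n => ?_
  simp only [Function.comp_apply, rowFactorError]
  ring

lemma tendsto_mul_one_sub_pow (hp : ∀ n, p n ∈ Set.Icc (0 : ℝ) 1)
    (hlim : Tendsto (fun n : ℕ => (n : ℝ) * p n - Real.log n) atTop (nhds c)) :
    Tendsto (fun n : ℕ => (n : ℝ) * (1 - p n) ^ n) atTop (nhds (Real.exp (-c))) := by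
  have h1 : Tendsto (fun n : ℕ => ((1 - p n) * Real.exp (p n)) ^ n) atTop (nhds 1) := by
    have h0 := (tendsto_mul_pow_succ_of_sub_log hlim 1).const_sub 1
    rw [sub_zero] at h0
    refine tendsto_of_tendsto_of_tendsto_of_le_of_le h0 tendsto_const_nhds (fun n => ?_)
      fun n => ?_
    · have hn := hp n
      have hb := one_add_mul_le_pow (a := -(p n ^ 2)) (by nlinarith [hn.1, hn.2]) n
      have h2 : 1 + -(p n ^ 2) ≤ (1 - p n) * Real.exp (p n) := by
        have := mul_le_mul_of_nonneg_left (Real.add_one_le_exp (p n)) (sub_nonneg.2 hn.2)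
        linarith
      have h3 := pow_le_pow_left₀ (by nlinarith [hn.1, hn.2]) h2 n
      refine le_trans (le_of_eq ?_) (hb.trans h3)
      ring
    · refine pow_le_one₀ (mul_nonneg (sub_nonneg.2 (hp n).2) (Real.exp_nonneg _)) ?_
      have := mul_le_mul_of_nonneg_right (Real.one_sub_le_exp_neg (p n)) (Real.exp_nonneg (p n))
      rwa [← Real.exp_add, neg_add_cancel, Real.exp_zero] at this
  have h := (tendsto_mul_exp_neg_of_sub_log hlim).mul h1
  rw [mul_one] at h
  refine h.congr fun n => ?_
  rw [mul_pow, ← Real.exp_nat_mul, mul_mul_mul_comm, mul_assoc, ← Real.exp_add]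
  simp

lemma tendsto_mul_emptyRowProb (hp : ∀ n, p n ∈ Set.Icc (0 : ℝ) 1)
    (hlim : Tendsto (fun n : ℕ => (n : ℝ) * p n - Real.log n) atTop (nhds c)) :
    Tendsto (fun n : ℕ => (n : ℝ) * emptyRowProb n (p n) q) atTop
      (nhds ((1 - q) * Real.exp (-c))) := by
  have h0 := tendsto_zero_of_sub_log hlim
  have h := ((tendsto_mul_one_sub_pow hp hlim).const_mul (1 - q)).div (h0.const_sub 1)
    (by norm_num)
  rw [sub_zero, div_one] at h
  refine h.congr' ?_
  filter_upwards [eventually_gt_atTop 0, h0.eventually_lt_const one_pos] with n hn hpn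
  have h1 : 1 - p n ≠ 0 := by linarith
  simp only [Pi.div_apply]
  rw [emptyRowProb, div_eq_iff h1, ← Nat.sub_add_cancel hn, pow_succ]
  simp only [Nat.add_sub_cancel]
  ring

lemma tendsto_emptyRowProb (hp : ∀ n, p n ∈ Set.Icc (0 : ℝ) 1)
    (hlim : Tendsto (fun n : ℕ => (n : ℝ) * p n - Real.log n) atTop (nhds c)) :
    Tendsto (fun n : ℕ => emptyRowProb n (p n) q) atTop (nhds 0) := by
  have h := (tendsto_mul_emptyRowProb (q := q) hp hlim).mul
    (tendsto_inv_atTop_nhds_zero_nat (𝕜 := ℝ))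
  rw [mul_zero] at h
  refine h.congr' ?_
  filter_upwards [eventually_gt_atTop 0] with n hn
  have hn' : (n : ℝ) ≠ 0 := Nat.cast_ne_zero.2 hn.ne'
  field_simp

lemma tendsto_choose_mul_emptyColsProb (hp : ∀ n, p n ∈ Set.Icc (0 : ℝ) 1)
    (hlim : Tendsto (fun n : ℕ => (n : ℝ) * p n - Real.log n) atTop (nhds c)) (s : ℕ) :
    Tendsto (fun n : ℕ => n.choose s * emptyColsProb n s (p n) q) atTop
      (nhds (Real.exp (-((1 - q) * Real.exp (-c))) *
        (((1 - q) * Real.exp (-c)) ^ s / s.factorial))) := by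
  have h0 := tendsto_zero_of_sub_log hlim
  have hr := tendsto_emptyRowProb (q := q) hp hlim
  have hpow : ∀ k : ℕ, Tendsto (fun n => (1 - p n) ^ k) atTop (nhds 1) := fun k => by
    simpa using (h0.const_sub 1).pow k
  have h1 := ProbabilityTheory.tendsto_choose_mul_pow_atTop s (tendsto_mul_one_sub_pow hp hlim)
  have h2 : Tendsto (fun n : ℕ => (1 + -(emptyRowProb n (p n) q / (1 - p n) ^ s)) ^ n) atTop
      (nhds (Real.exp (-((1 - q) * Real.exp (-c))))) := by
    refine Real.tendsto_one_add_pow_exp_of_tendsto ?_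
    have h := ((tendsto_mul_emptyRowProb (q := q) hp hlim).div (hpow s) one_ne_zero).neg
    rw [div_one] at h
    refine h.congr fun n => ?_
    simp only [Pi.div_apply]
    ring
  have h3 : Tendsto (fun n => (1 - p n) ^ s - emptyRowProb n (p n) q) atTop (nhds 1) := by
    simpa using (hpow s).sub hr
  have h4 : Tendsto (fun n => ((1 - q) * (1 - p n) ^ (s - 1) - emptyRowProb n (p n) q) ^ s) atTop
      (nhds ((1 - q) ^ s)) := by
    simpa using (((hpow (s - 1)).const_mul (1 - q)).sub hr).pow s
  have h := ((h1.mul h2).mul h4).div (h3.pow s) (by simp)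
  have hval : Real.exp (-c) ^ s / s.factorial * Real.exp (-((1 - q) * Real.exp (-c))) *
      (1 - q) ^ s / 1 ^ s =
      Real.exp (-((1 - q) * Real.exp (-c))) * (((1 - q) * Real.exp (-c)) ^ s / s.factorial) := by
    rw [one_pow, mul_pow]
    ring
  rw [hval] at h
  refine h.congr' ?_
  filter_upwards [eventually_ge_atTop s, h0.eventually_lt_const one_pos,
    h3.eventually_const_lt one_pos] with n hn hpn hpos
  have h5 : (1 - p n) ^ s ≠ 0 := pow_ne_zero _ (by linarith)
  simp only [Pi.div_apply]
  rw [emptyColsProb, div_eq_iff (pow_ne_zero _ hpos.ne')]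
  have h6 : ((1 - p n) ^ s - emptyRowProb n (p n) q) ^ (n - s) *
      ((1 - p n) ^ s - emptyRowProb n (p n) q) ^ s =
      ((1 - p n) ^ n) ^ s * (1 + -(emptyRowProb n (p n) q / (1 - p n) ^ s)) ^ n := by
    rw [← pow_add, Nat.sub_add_cancel hn, ← pow_mul, mul_comm n s, pow_mul, ← mul_pow]
    congr 1
    field_simp
    ring
  linear_combination (-(n.choose s : ℝ) *
    ((1 - q) * (1 - p n) ^ (s - 1) - emptyRowProb n (p n) q) ^ s) * h6

lemma two_mul_exp_neg_sub_le_liminf (hq : q ∈ Set.Icc (0 : ℝ) 1)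
    (hp : ∀ n, p n ∈ Set.Icc (0 : ℝ) 1)
    (hlim : Tendsto (fun n : ℕ => (n : ℝ) * p n - Real.log n) atTop (nhds c)) {l : ℝ}
    (hl : l = (1 - q) * Real.exp (-c)) (K : ℕ) :
    2 * Real.exp (-l) - (∑ s ∈ range (2 * K + 1), (-1) ^ s * (Real.exp (-l) *
      (l ^ s / s.factorial))) - 2 * (l ^ (K + 1) / (K + 1).factorial) ≤
    liminf (fun n : ℕ => digraphProb n (p n) q {E | StructurallyDiagonalizable n E}) atTop := by
  subst hl
  have hr := tendsto_mul_emptyRowProb (q := q) hp hlim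
  have h0 := tendsto_zero_of_sub_log hlim
  have h1 := Real.tendsto_one_add_pow_exp_of_tendsto
    (g := fun n => -emptyRowProb n (p n) q) (by simpa only [mul_neg] using hr.neg)
  have h2 := Real.tendsto_one_add_pow_exp_of_tendsto hr
  have h3 := tendsto_finsetSum (range (2 * K + 1)) fun s _ =>
    (tendsto_choose_mul_emptyColsProb (q := q) hp hlim s).const_mul ((-1) ^ s)
  have h4 := ((hr.pow (K + 1)).div_const ((K + 1).factorial : ℝ)).add
    (h2.mul (tendsto_rowFactorError hlim K))
  have h := ((h1.const_mul 2).sub h3).sub (h4.const_mul 2)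
  rw [mul_zero, add_zero] at h
  have hbdd : IsBoundedUnder (· ≤ ·) atTop (fun n : ℕ =>
      digraphProb n (p n) q {E | StructurallyDiagonalizable n E}) :=
    isBoundedUnder_of ⟨1, fun n => by
      rw [digraphProb_eq_bernProb]
      exact bernProb_le_one (hp n) hq _⟩
  rw [← h.liminf_eq]
  refine liminf_le_liminf ?_ h.isBoundedUnder_ge hbdd.isCoboundedUnder_ge
  have hK : Tendsto (fun n => p n * (K + 2)) atTop (nhds 0) := by
    simpa using h0.mul_const ((K : ℝ) + 2)
  filter_upwards [hK.eventually_le_const one_pos,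
    (tendsto_hallRatio.comp (tendsto_mul_atTop_of_sub_log hlim)).eventually_le_const
      (half_pos one_pos), (tendsto_mul_atTop_of_sub_log hlim).eventually_gt_atTop 0]
    with n hn1 hn2 hn3
  have hpos : 0 < p n := (hp n).1.lt_of_ne fun h => by simp [← h] at hn3
  exact le_digraphProb_structurallyDiagonalizable ⟨hpos, (hp n).2⟩ hq hn1 hn2 K

lemma tendsto_alternating_sum_exp (l : ℝ) :
    Tendsto (fun K : ℕ => 2 * Real.exp (-l) - (∑ s ∈ range (2 * K + 1), (-1) ^ s *
      (Real.exp (-l) * (l ^ s / s.factorial))) - 2 * (l ^ (K + 1) / (K + 1).factorial)) atTop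
      (nhds (2 * Real.exp (-l) - Real.exp (-l) * Real.exp (-l))) := by
  have h1 : Tendsto (fun K : ℕ => 2 * K + 1) atTop atTop :=
    tendsto_atTop_mono (fun K => by simp only [id_eq]; omega) tendsto_id
  have h2 := ((NormedSpace.expSeries_div_hasSum_exp (-l)).tendsto_sum_nat.comp h1).const_mul
    (Real.exp (-l))
  rw [← Real.exp_eq_exp_ℝ] at h2
  have h3 := ((FloorSemiring.tendsto_pow_div_factorial_atTop l).comp
    (tendsto_add_atTop_nat 1)).const_mul 2
  have h := (h2.const_sub (2 * Real.exp (-l))).sub h3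
  rw [mul_zero, sub_zero] at h
  refine h.congr fun K => ?_
  simp only [Function.comp_apply, mul_sum]
  congr 2
  refine sum_congr rfl fun s _ => ?_
  rw [neg_pow l s]
  ring

end Asymptotics

/-- If `n·p_n - log n → c` and `q ∈ [0,1]` is constant, then
`liminf P(G_{n,p_n,q} ∈ D^n) ≥ exp(-2(1-q)e^{-c})·(1 + 2(1-q)e^{-c} + (1-q)²e^{-2c})`. -/
theorem liminf_prob_structurallyDiagonalizable_selfloop_ge (c : ℝ) (q : ℝ)
    (hq : q ∈ Set.Icc (0 : ℝ) 1) (p : ℕ → ℝ)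
    (hp : ∀ n, p n ∈ Set.Icc (0 : ℝ) 1)
    (hlim : Tendsto (fun n : ℕ => (n : ℝ) * p n - Real.log n) atTop (nhds c)) :
    Real.exp (-(2 * (1 - q) * Real.exp (-c))) *
        (1 + 2 * (1 - q) * Real.exp (-c) + (1 - q) ^ 2 * Real.exp (-(2 * c)))
      ≤ liminf (fun n : ℕ =>
          digraphProb n (p n) q {E | StructurallyDiagonalizable n E}) atTop := by
  have hl : 0 ≤ (1 - q) * Real.exp (-c) := mul_nonneg (sub_nonneg.2 hq.2) (Real.exp_nonneg _)
  have h := le_of_tendsto' (tendsto_alternating_sum_exp ((1 - q) * Real.exp (-c)))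
    (two_mul_exp_neg_sub_le_liminf hq hp hlim rfl)
  refine le_trans ?_ h
  have hc : Real.exp (-(2 * c)) = Real.exp (-c) ^ 2 := by
    rw [← Real.exp_nat_mul]
    congr 1
    push_cast
    ring
  rw [hc, mul_assoc 2, ← mul_pow]
  generalize (1 - q) * Real.exp (-c) = l at hl
  have h2 : Real.exp (-(2 * l)) = Real.exp (-l) * Real.exp (-l) := by
    rw [← Real.exp_add]
    congr 1
    ring
  have h3 : Real.exp (-l) = Real.exp (-l) * Real.exp (-l) * Real.exp l := by
    rw [mul_assoc, ← Real.exp_add]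
    simp
  have h4 := mul_le_mul_of_nonneg_left (Real.quadratic_le_exp_of_nonneg hl)
    (mul_self_nonneg (Real.exp (-l)))
  rw [h2]
  linarith
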